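/- arXiv:math/0208140 — 2 statements merged into one kernel-verified Lean document; each statement's English description precedes it below -/
import Mathlib

section
/- In the algebra 𝒮 with generators s_ij (1 ≤ i,j ≤ N) and defining relations s_ij = 0 for i < j, s_ii = 1, and R S₁ Rᵗ S₂ = S₂ Rᵗ S₁ R, the ordered monomials s_21^{k_21} s_31^{k_31} s_32^{k_32} ⋯ s_N1^{k_N1} s_N2^{k_N2} ⋯ s_{N,N−1}^{k_{N,N−1}}, taken over the generators s_ij with i > j in lexicographic order of (i,j) and with arbitrary nonnegative integer exponents, form a vector space basis of 𝒮. -/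
noncomputable section

open scoped TensorProduct

abbrev FF : Type := RatFunc ℂ

def qq : FF := RatFunc.X

/-! Constant R-matrices acting in `ℂ^N ⊗ ℂ^N`, written as matrices indexed by pairs. -/

def Rc (F : Type) [Field F] (q : F) (N : ℕ) :
    Matrix (Fin N × Fin N) (Fin N × Fin N) F := Matrix.of fun p r =>
  (if p = r then (if p.1 = p.2 then q else 1) else 0)
  + (if p.1 = r.2 ∧ p.2 = r.1 ∧ p.1 < p.2 then q - q⁻¹ else 0)

/-- `R` transposed in the first tensor factor. -/
def Rct (F : Type) [Field F] (q : F) (N : ℕ) :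
    Matrix (Fin N × Fin N) (Fin N × Fin N) F :=
  Matrix.of fun p r => Rc F q N (r.1, p.2) (p.1, r.2)

def Rtil (F : Type) [Field F] (q : F) (N : ℕ) :
    Matrix (Fin N × Fin N) (Fin N × Fin N) F := Matrix.of fun p r =>
  (if p = r then (if p.1 = p.2 then q⁻¹ else 1) else 0)
  + (if p.1 = r.2 ∧ p.2 = r.1 ∧ p.2 < p.1 then q⁻¹ - q else 0)

def Rtilt (F : Type) [Field F] (q : F) (N : ℕ) :
    Matrix (Fin N × Fin N) (Fin N × Fin N) F :=
  Matrix.of fun p r => Rtil F q N (r.1, p.2) (p.1, r.2)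

/-- `S ↦ S ⊗ 1` (action in the first copy of `End ℂ^N`). -/
def amp1 {A : Type} [Ring A] {N : ℕ} (M : Matrix (Fin N) (Fin N) A) :
    Matrix (Fin N × Fin N) (Fin N × Fin N) A :=
  Matrix.of fun p r => if p.2 = r.2 then M p.1 r.1 else 0

/-- `S ↦ 1 ⊗ S` (action in the second copy of `End ℂ^N`). -/
def amp2 {A : Type} [Ring A] {N : ℕ} (M : Matrix (Fin N) (Fin N) A) :
    Matrix (Fin N × Fin N) (Fin N × Fin N) A :=
  Matrix.of fun p r => if p.1 = r.1 then M p.2 r.2 else 0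

/-- A scalar matrix viewed as a matrix over an `F`-algebra `A`. -/
def liftF (F : Type) [Field F] {A : Type} [Ring A] [Algebra F A] {m : Type}
    (M : Matrix m m F) : Matrix m m A := M.map (algebraMap F A)

/-- Left hand side `R S₁ Rᵗ S₂` of the reflection equation. -/
def reflLHS (F : Type) [Field F] (q : F) {N : ℕ} {A : Type} [Ring A] [Algebra F A]
    (S : Matrix (Fin N) (Fin N) A) : Matrix (Fin N × Fin N) (Fin N × Fin N) A :=
  liftF F (Rc F q N) * amp1 S * liftF F (Rct F q N) * amp2 S

/-- Right hand side `S₂ Rᵗ S₁ R` of the reflection equation. -/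
def reflRHS (F : Type) [Field F] (q : F) {N : ℕ} {A : Type} [Ring A] [Algebra F A]
    (S : Matrix (Fin N) (Fin N) A) : Matrix (Fin N × Fin N) (Fin N × Fin N) A :=
  amp2 S * liftF F (Rct F q N) * amp1 S * liftF F (Rc F q N)

/-- The list of index pairs `(i,j)` in lexicographic order. -/
def lexPairs (N : ℕ) : List (Fin N × Fin N) :=
  (List.finRange N).flatMap fun i => (List.finRange N).map fun j => (i, j)

/-! The generic matrix of generators. -/

def Sfree (F : Type) [Field F] (N : ℕ) :
    Matrix (Fin N) (Fin N) (FreeAlgebra F (Fin N × Fin N)) :=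
  Matrix.of fun i j => FreeAlgebra.ι F (i, j)

/-- Defining relations: only the reflection equation. -/
inductive Rel0 (F : Type) [Field F] (q : F) (N : ℕ) :
    FreeAlgebra F (Fin N × Fin N) → FreeAlgebra F (Fin N × Fin N) → Prop
  | refl (p r : Fin N × Fin N) :
      Rel0 F q N (reflLHS F q (Sfree F N) p r) (reflRHS F q (Sfree F N) p r)

/-- The algebra with generators `s_ij` and the reflection equation as defining relations. -/
abbrev Alg0 (F : Type) [Field F] (q : F) (N : ℕ) := RingQuot (Rel0 F q N)

def s0 (F : Type) [Field F] (q : F) (N : ℕ) (i j : Fin N) : Alg0 F q N :=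
  RingQuot.mkAlgHom F (Rel0 F q N) (FreeAlgebra.ι F (i, j))

/-- Defining relations of the presented algebra `𝒮` of the orthogonal case. -/
inductive OSRel (F : Type) [Field F] (q : F) (N : ℕ) :
    FreeAlgebra F (Fin N × Fin N) → FreeAlgebra F (Fin N × Fin N) → Prop
  | tri (i j : Fin N) (h : i < j) : OSRel F q N (FreeAlgebra.ι F (i, j)) 0
  | diag (i : Fin N) : OSRel F q N (FreeAlgebra.ι F (i, i)) 1
  | refl (p r : Fin N × Fin N) :
      OSRel F q N (reflLHS F q (Sfree F N) p r) (reflRHS F q (Sfree F N) p r)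

abbrev AlgOS (F : Type) [Field F] (q : F) (N : ℕ) := RingQuot (OSRel F q N)

def sOS (F : Type) [Field F] (q : F) (N : ℕ) (i j : Fin N) : AlgOS F q N :=
  RingQuot.mkAlgHom F (OSRel F q N) (FreeAlgebra.ι F (i, j))

/-! The quantized enveloping algebra `U_q(gl_N)` by its RTT presentation. -/

abbrev GlGen (N : ℕ) := (Fin N × Fin N) ⊕ (Fin N × Fin N)

def Tfree (F : Type) [Field F] (N : ℕ) :
    Matrix (Fin N) (Fin N) (FreeAlgebra F (GlGen N)) :=
  Matrix.of fun i j => FreeAlgebra.ι F (Sum.inl (i, j))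

def Tbfree (F : Type) [Field F] (N : ℕ) :
    Matrix (Fin N) (Fin N) (FreeAlgebra F (GlGen N)) :=
  Matrix.of fun i j => FreeAlgebra.ι F (Sum.inr (i, j))

/-- `R X₁ Y₂` -/
def rttLHS (F : Type) [Field F] (q : F) {N : ℕ} {A : Type} [Ring A] [Algebra F A]
    (X Y : Matrix (Fin N) (Fin N) A) : Matrix (Fin N × Fin N) (Fin N × Fin N) A :=
  liftF F (Rc F q N) * amp1 X * amp2 Y

/-- `Y₂ X₁ R` -/
def rttRHS (F : Type) [Field F] (q : F) {N : ℕ} {A : Type} [Ring A] [Algebra F A]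
    (X Y : Matrix (Fin N) (Fin N) A) : Matrix (Fin N × Fin N) (Fin N × Fin N) A :=
  amp2 Y * amp1 X * liftF F (Rc F q N)

inductive GlRel (F : Type) [Field F] (q : F) (N : ℕ) :
    FreeAlgebra F (GlGen N) → FreeAlgebra F (GlGen N) → Prop
  | t_zero (i j : Fin N) (h : i < j) : GlRel F q N (Tfree F N i j) 0
  | tb_zero (i j : Fin N) (h : j < i) : GlRel F q N (Tbfree F N i j) 0
  | t_tb (i : Fin N) : GlRel F q N (Tfree F N i i * Tbfree F N i i) 1
  | tb_t (i : Fin N) : GlRel F q N (Tbfree F N i i * Tfree F N i i) 1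
  | rtt (p r : Fin N × Fin N) :
      GlRel F q N (rttLHS F q (Tfree F N) (Tfree F N) p r)
        (rttRHS F q (Tfree F N) (Tfree F N) p r)
  | rtbtb (p r : Fin N × Fin N) :
      GlRel F q N (rttLHS F q (Tbfree F N) (Tbfree F N) p r)
        (rttRHS F q (Tbfree F N) (Tbfree F N) p r)
  | rtbt (p r : Fin N × Fin N) :
      GlRel F q N (rttLHS F q (Tbfree F N) (Tfree F N) p r)
        (rttRHS F q (Tbfree F N) (Tfree F N) p r)

/-- The quantized enveloping algebra `U_q(gl_N)`. -/
abbrev UqGl (F : Type) [Field F] (q : F) (N : ℕ) := RingQuot (GlRel F q N)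

def tE (F : Type) [Field F] (q : F) (N : ℕ) (i j : Fin N) : UqGl F q N :=
  RingQuot.mkAlgHom F (GlRel F q N) (FreeAlgebra.ι F (Sum.inl (i, j)))

def tbE (F : Type) [Field F] (q : F) (N : ℕ) (i j : Fin N) : UqGl F q N :=
  RingQuot.mkAlgHom F (GlRel F q N) (FreeAlgebra.ι F (Sum.inr (i, j)))

/-- The entries `s_ij = Σ_a t_ia t̄_ja` of `S = T T̄ᵗ`. -/
def sE (F : Type) [Field F] (q : F) (N : ℕ) (i j : Fin N) : UqGl F q N :=
  ∑ a : Fin N, tE F q N i a * tbE F q N j a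

/-- The twisted quantized enveloping algebra `U^tw_q(o_N)` as a subalgebra of `U_q(gl_N)`. -/
def UtwO (F : Type) [Field F] (q : F) (N : ℕ) : Subalgebra F (UqGl F q N) :=
  Algebra.adjoin F {x | ∃ i j, x = sE F q N i j}

/-! Symplectic (finite) case. -/

/-- `2k` as an element of `Fin (2n)` (the 0-based version of the odd index `2k-1`). -/
def fe (n : ℕ) (k : Fin n) : Fin (2 * n) := ⟨2 * k.val, by have := k.isLt; omega⟩

/-- `2k+1` as an element of `Fin (2n)` (the 0-based version of the even index `2k`). -/
def fo (n : ℕ) (k : Fin n) : Fin (2 * n) := ⟨2 * k.val + 1, by have := k.isLt; omega⟩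

/-- The entries `s_ij` of `S = T G T̄ᵗ` in `U_q(gl_2n)`. -/
def sSp (F : Type) [Field F] (q : F) (n : ℕ) (i j : Fin (2 * n)) : UqGl F q (2 * n) :=
  algebraMap F _ q * ∑ a : Fin n, tE F q (2 * n) i (fe n a) * tbE F q (2 * n) j (fo n a)
    - ∑ a : Fin n, tE F q (2 * n) i (fo n a) * tbE F q (2 * n) j (fe n a)

abbrev SpGen (n : ℕ) := (Fin (2 * n) × Fin (2 * n)) ⊕ Fin n

def SpFreeS (F : Type) [Field F] (n : ℕ) :
    Matrix (Fin (2 * n)) (Fin (2 * n)) (FreeAlgebra F (SpGen n)) :=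
  Matrix.of fun i j => FreeAlgebra.ι F (Sum.inl (i, j))

/-- Defining relations of the presented algebra `𝒮` of the symplectic case. -/
inductive SpRel (F : Type) [Field F] (q : F) (n : ℕ) :
    FreeAlgebra F (SpGen n) → FreeAlgebra F (SpGen n) → Prop
  | tri (i j : Fin (2 * n)) (h : i < j) (h' : ¬(i.val % 2 = 0 ∧ j.val = i.val + 1)) :
      SpRel F q n (FreeAlgebra.ι F (Sum.inl (i, j))) 0
  | quad (k : Fin n) :
      SpRel F q n
        (FreeAlgebra.ι F (Sum.inl (fo n k, fo n k)) * FreeAlgebra.ι F (Sum.inl (fe n k, fe n k)))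
        (algebraMap F _ (q ^ 2) *
            (FreeAlgebra.ι F (Sum.inl (fo n k, fe n k)) *
              FreeAlgebra.ι F (Sum.inl (fe n k, fo n k)))
          + algebraMap F _ (q ^ 3))
  | invR (k : Fin n) :
      SpRel F q n
        (FreeAlgebra.ι F (Sum.inl (fe n k, fo n k)) * FreeAlgebra.ι F (Sum.inr k)) 1
  | invL (k : Fin n) :
      SpRel F q n
        (FreeAlgebra.ι F (Sum.inr k) * FreeAlgebra.ι F (Sum.inl (fe n k, fo n k))) 1
  | refl (p r : Fin (2 * n) × Fin (2 * n)) :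
      SpRel F q n (reflLHS F q (SpFreeS F n) p r) (reflRHS F q (SpFreeS F n) p r)

abbrev AlgSp (F : Type) [Field F] (q : F) (n : ℕ) := RingQuot (SpRel F q n)

def sSpP (F : Type) [Field F] (q : F) (n : ℕ) (i j : Fin (2 * n)) : AlgSp F q n :=
  RingQuot.mkAlgHom F (SpRel F q n) (FreeAlgebra.ι F (Sum.inl (i, j)))

def sInvP (F : Type) [Field F] (q : F) (n : ℕ) (k : Fin n) : AlgSp F q n :=
  RingQuot.mkAlgHom F (SpRel F q n) (FreeAlgebra.ι F (Sum.inr k))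

/-- row `i = 2k` of the symplectic ordered monomial: positions `(i,0),…,(i,2k)`. -/
def rowA (n : ℕ) (k : Fin n) : List (Fin (2 * n) × Fin (2 * n)) :=
  ((List.finRange (2 * n)).filter fun j => j.val ≤ 2 * k.val).map fun j => (fe n k, j)

/-- row `i' = 2k+1` of the symplectic ordered monomial: positions `(i',0),…,(i',2k-1)`. -/
def rowB (n : ℕ) (k : Fin n) : List (Fin (2 * n) × Fin (2 * n)) :=
  ((List.finRange (2 * n)).filter fun j => j.val + 2 ≤ 2 * k.val + 1).map fun j => (fo n k, j)

/-- The ordered monomials of the symplectic case, with an arbitrary integer exponent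
on each `s_{i i'}` and nonnegative exponents elsewhere. -/
def monomSp {A : Type} [Ring A] (n : ℕ) (s : Fin (2 * n) × Fin (2 * n) → A) (sI : Fin n → A)
    (kN : Fin (2 * n) × Fin (2 * n) → ℕ) (kZ : Fin n → ℤ) : A :=
  ((List.finRange n).map fun k =>
    ((rowA n k).map fun p => s p ^ kN p).prod *
      (if 0 ≤ kZ k then s (fe n k, fo n k) ^ (kZ k).toNat else sI k ^ (-(kZ k)).toNat) *
      s (fo n k, fo n k) ^ kN (fo n k, fo n k) *
      ((rowB n k).map fun p => s p ^ kN p).prod).prod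

/-! Affine (twisted q-Yangian) machinery.  Series are treated coefficientwise. -/

/-- `z1 S r` is the coefficient matrix (in the first copy) of a series indexed by
nonnegative integers, extended by zero to `ℤ`. -/
def z1 {A : Type} [Ring A] {N : ℕ} (S : ℕ → Matrix (Fin N) (Fin N) A) (r : ℤ) :
    Matrix (Fin N × Fin N) (Fin N × Fin N) A :=
  if 0 ≤ r then amp1 (S r.toNat) else 0

def z2 {A : Type} [Ring A] {N : ℕ} (S : ℕ → Matrix (Fin N) (Fin N) A) (r : ℤ) :
    Matrix (Fin N × Fin N) (Fin N × Fin N) A :=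
  if 0 ≤ r then amp2 (S r.toNat) else 0

/-- Coefficient of `u^a v^b` in `R(u,v) S₁(u) Rᵗ(u⁻¹,v) S₂(v)`,
using `R(u,v) = u R̃ - v R` and `Rᵗ(u⁻¹,v) = u⁻¹ R̃ᵗ - v Rᵗ`. -/
def affLHS (F : Type) [Field F] (q : F) {N : ℕ} {A : Type} [Ring A] [Algebra F A]
    (S : ℕ → Matrix (Fin N) (Fin N) A) (a b : ℤ) :
    Matrix (Fin N × Fin N) (Fin N × Fin N) A :=
  liftF F (Rtil F q N) * z1 S (-a) * liftF F (Rtilt F q N) * z2 S (-b)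
    - liftF F (Rtil F q N) * z1 S (1 - a) * liftF F (Rct F q N) * z2 S (1 - b)
    - liftF F (Rc F q N) * z1 S (-1 - a) * liftF F (Rtilt F q N) * z2 S (1 - b)
    + liftF F (Rc F q N) * z1 S (-a) * liftF F (Rct F q N) * z2 S (2 - b)

/-- Coefficient of `u^a v^b` in `S₂(v) Rᵗ(u⁻¹,v) S₁(u) R(u,v)`. -/
def affRHS (F : Type) [Field F] (q : F) {N : ℕ} {A : Type} [Ring A] [Algebra F A]
    (S : ℕ → Matrix (Fin N) (Fin N) A) (a b : ℤ) :
    Matrix (Fin N × Fin N) (Fin N × Fin N) A :=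
  z2 S (-b) * liftF F (Rtilt F q N) * z1 S (-a) * liftF F (Rtil F q N)
    - z2 S (1 - b) * liftF F (Rtilt F q N) * z1 S (-1 - a) * liftF F (Rc F q N)
    - z2 S (1 - b) * liftF F (Rct F q N) * z1 S (1 - a) * liftF F (Rtil F q N)
    + z2 S (2 - b) * liftF F (Rct F q N) * z1 S (-a) * liftF F (Rc F q N)

def SfreeA (F : Type) [Field F] (N : ℕ) (r : ℕ) :
    Matrix (Fin N) (Fin N) (FreeAlgebra F (ℕ × Fin N × Fin N)) :=
  Matrix.of fun i j => FreeAlgebra.ι F (r, i, j)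

/-- Defining relations: only the affine reflection equation (coefficientwise). -/
inductive Rel9 (F : Type) [Field F] (q : F) (N : ℕ) :
    FreeAlgebra F (ℕ × Fin N × Fin N) → FreeAlgebra F (ℕ × Fin N × Fin N) → Prop
  | refl (a b : ℤ) (p r : Fin N × Fin N) :
      Rel9 F q N (affLHS F q (SfreeA F N) a b p r) (affRHS F q (SfreeA F N) a b p r)

abbrev Alg9 (F : Type) [Field F] (q : F) (N : ℕ) := RingQuot (Rel9 F q N)

def s9 (F : Type) [Field F] (q : F) (N : ℕ) (r : ℕ) (i j : Fin N) : Alg9 F q N :=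
  RingQuot.mkAlgHom F (Rel9 F q N) (FreeAlgebra.ι F (r, i, j))

/-- Defining relations of the presented twisted q-Yangian (orthogonal case). -/
inductive AORel (F : Type) [Field F] (q : F) (N : ℕ) :
    FreeAlgebra F (ℕ × Fin N × Fin N) → FreeAlgebra F (ℕ × Fin N × Fin N) → Prop
  | tri (i j : Fin N) (h : i < j) : AORel F q N (FreeAlgebra.ι F (0, i, j)) 0
  | diag (i : Fin N) : AORel F q N (FreeAlgebra.ι F (0, i, i)) 1
  | refl (a b : ℤ) (p r : Fin N × Fin N) :
      AORel F q N (affLHS F q (SfreeA F N) a b p r) (affRHS F q (SfreeA F N) a b p r)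

abbrev AlgAO (F : Type) [Field F] (q : F) (N : ℕ) := RingQuot (AORel F q N)

def sAO (F : Type) [Field F] (q : F) (N : ℕ) (r : ℕ) (i j : Fin N) : AlgAO F q N :=
  RingQuot.mkAlgHom F (AORel F q N) (FreeAlgebra.ι F (r, i, j))

/-- Lexicographic (non-strict) comparison of triples. -/
def tripLe (x y : ℕ × ℕ × ℕ) : Prop :=
  x.1 < y.1 ∨ (x.1 = y.1 ∧ (x.2.1 < y.2.1 ∨ (x.2.1 = y.2.1 ∧ x.2.2 ≤ y.2.2)))

/-- A list of generator indices `(r,i,j)` is ordered if it is weakly increasing with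
respect to the lexicographic order on `(r,i,j)`. -/
def sortedGens {N : ℕ} (l : List (ℕ × Fin N × Fin N)) : Prop :=
  l.Chain' fun x y => tripLe (x.1, x.2.1.val, x.2.2.val) (y.1, y.2.1.val, y.2.2.val)

/-! The quantum affine algebra `U_q(ĝl_N)` by its RTT presentation, coefficientwise. -/

abbrev AffGen (N : ℕ) := (ℕ × Fin N × Fin N) ⊕ (ℕ × Fin N × Fin N)

def TfA (F : Type) [Field F] (N : ℕ) (r : ℕ) :
    Matrix (Fin N) (Fin N) (FreeAlgebra F (AffGen N)) :=
  Matrix.of fun i j => FreeAlgebra.ι F (Sum.inl (r, i, j))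

def TbfA (F : Type) [Field F] (N : ℕ) (r : ℕ) :
    Matrix (Fin N) (Fin N) (FreeAlgebra F (AffGen N)) :=
  Matrix.of fun i j => FreeAlgebra.ι F (Sum.inr (r, i, j))

/-- Coefficient of `u^a v^b` in `R(u,v) X₁ Y₂` with prescribed coefficient extractions. -/
def affRttL (F : Type) [Field F] (q : F) {N : ℕ} {A : Type} [Ring A] [Algebra F A]
    (X Y : ℕ → Matrix (Fin N) (Fin N) A) (a b a' b' : ℤ) :
    Matrix (Fin N × Fin N) (Fin N × Fin N) A :=
  liftF F (Rtil F q N) * z1 X a * z2 Y b - liftF F (Rc F q N) * z1 X a' * z2 Y b'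

def affRttR (F : Type) [Field F] (q : F) {N : ℕ} {A : Type} [Ring A] [Algebra F A]
    (X Y : ℕ → Matrix (Fin N) (Fin N) A) (a b a' b' : ℤ) :
    Matrix (Fin N × Fin N) (Fin N × Fin N) A :=
  z2 Y b * z1 X a * liftF F (Rtil F q N) - z2 Y b' * z1 X a' * liftF F (Rc F q N)

inductive AffGlRel (F : Type) [Field F] (q : F) (N : ℕ) :
    FreeAlgebra F (AffGen N) → FreeAlgebra F (AffGen N) → Prop
  | t0_tri (i j : Fin N) (h : i < j) : AffGlRel F q N (TfA F N 0 i j) 0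
  | tb0_tri (i j : Fin N) (h : j < i) : AffGlRel F q N (TbfA F N 0 i j) 0
  | t_tb (i : Fin N) : AffGlRel F q N (TfA F N 0 i i * TbfA F N 0 i i) 1
  | tb_t (i : Fin N) : AffGlRel F q N (TbfA F N 0 i i * TfA F N 0 i i) 1
  | rtt (a b : ℤ) (p r : Fin N × Fin N) :
      AffGlRel F q N
        (affRttL F q (TfA F N) (TfA F N) (1 - a) (-b) (-a) (1 - b) p r)
        (affRttR F q (TfA F N) (TfA F N) (1 - a) (-b) (-a) (1 - b) p r)
  | rtbtb (a b : ℤ) (p r : Fin N × Fin N) :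
      AffGlRel F q N
        (affRttL F q (TbfA F N) (TbfA F N) (a - 1) b a (b - 1) p r)
        (affRttR F q (TbfA F N) (TbfA F N) (a - 1) b a (b - 1) p r)
  | rtbt (a b : ℤ) (p r : Fin N × Fin N) :
      AffGlRel F q N
        (affRttL F q (TbfA F N) (TfA F N) (a - 1) (-b) a (1 - b) p r)
        (affRttR F q (TbfA F N) (TfA F N) (a - 1) (-b) a (1 - b) p r)

/-- The quantum affine algebra `U_q(ĝl_N)`. -/
abbrev UqAff (F : Type) [Field F] (q : F) (N : ℕ) := RingQuot (AffGlRel F q N)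

def tA (F : Type) [Field F] (q : F) (N : ℕ) (r : ℕ) (i j : Fin N) : UqAff F q N :=
  RingQuot.mkAlgHom F (AffGlRel F q N) (FreeAlgebra.ι F (Sum.inl (r, i, j)))

def tbA (F : Type) [Field F] (q : F) (N : ℕ) (r : ℕ) (i j : Fin N) : UqAff F q N :=
  RingQuot.mkAlgHom F (AffGlRel F q N) (FreeAlgebra.ι F (Sum.inr (r, i, j)))

/-- Coefficient of `u^{-r}` in `s_ij(u) = Σ_a t_ia(u) t̄_ja(u⁻¹)`. -/
def Scoef (F : Type) [Field F] (q : F) (N : ℕ) (r : ℕ) (i j : Fin N) : UqAff F q N :=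
  ∑ a : Fin N, ∑ p ∈ Finset.range (r + 1), tA F q N p i a * tbA F q N (r - p) j a

/-- The twisted q-Yangian `Y^tw_q(o_N)` as a subalgebra of `U_q(ĝl_N)`. -/
def YtwO (F : Type) [Field F] (q : F) (N : ℕ) : Subalgebra F (UqAff F q N) :=
  Algebra.adjoin F {x | ∃ r i j, x = Scoef F q N r i j}

/-- Coefficient of `u^{-r}` in `s_ij(u)`, the `(i,j)` entry of `S(u) = T(u) G T̄(u⁻¹)ᵗ`
in the symplectic case. -/
def ScoefSp (F : Type) [Field F] (q : F) (n : ℕ) (r : ℕ) (i j : Fin (2 * n)) :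
    UqAff F q (2 * n) :=
  ∑ a : Fin n, ∑ p ∈ Finset.range (r + 1),
    (algebraMap F _ q * (tA F q (2 * n) p i (fe n a) * tbA F q (2 * n) (r - p) j (fo n a))
      - tA F q (2 * n) p i (fo n a) * tbA F q (2 * n) (r - p) j (fe n a))

/-- The twisted q-Yangian `Y^tw_q(sp_2n)` as a subalgebra of `U_q(ĝl_2n)`,
with a prescribed family of inverses of `s^{(0)}_{ii'}`. -/
def YtwSp (F : Type) [Field F] (q : F) (n : ℕ) (inv : Fin n → UqAff F q (2 * n)) :
    Subalgebra F (UqAff F q (2 * n)) :=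
  Algebra.adjoin F ({x | ∃ r i j, x = ScoefSp F q n r i j} ∪ Set.range inv)

abbrev ASpGen (n : ℕ) := (ℕ × Fin (2 * n) × Fin (2 * n)) ⊕ Fin n

def SfreeASp (F : Type) [Field F] (n : ℕ) (r : ℕ) :
    Matrix (Fin (2 * n)) (Fin (2 * n)) (FreeAlgebra F (ASpGen n)) :=
  Matrix.of fun i j => FreeAlgebra.ι F (Sum.inl (r, i, j))

/-- Defining relations of the presented twisted q-Yangian (symplectic case). -/
inductive ASpRel (F : Type) [Field F] (q : F) (n : ℕ) :
    FreeAlgebra F (ASpGen n) → FreeAlgebra F (ASpGen n) → Prop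
  | tri (i j : Fin (2 * n)) (h : i < j) (h' : ¬(i.val % 2 = 0 ∧ j.val = i.val + 1)) :
      ASpRel F q n (FreeAlgebra.ι F (Sum.inl (0, i, j))) 0
  | quad (k : Fin n) :
      ASpRel F q n
        (FreeAlgebra.ι F (Sum.inl (0, fo n k, fo n k)) *
          FreeAlgebra.ι F (Sum.inl (0, fe n k, fe n k)))
        (algebraMap F _ (q ^ 2) *
            (FreeAlgebra.ι F (Sum.inl (0, fo n k, fe n k)) *
              FreeAlgebra.ι F (Sum.inl (0, fe n k, fo n k)))
          + algebraMap F _ (q ^ 3))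
  | invR (k : Fin n) :
      ASpRel F q n
        (FreeAlgebra.ι F (Sum.inl (0, fe n k, fo n k)) * FreeAlgebra.ι F (Sum.inr k)) 1
  | invL (k : Fin n) :
      ASpRel F q n
        (FreeAlgebra.ι F (Sum.inr k) * FreeAlgebra.ι F (Sum.inl (0, fe n k, fo n k))) 1
  | refl (a b : ℤ) (p r : Fin (2 * n) × Fin (2 * n)) :
      ASpRel F q n (affLHS F q (SfreeASp F n) a b p r) (affRHS F q (SfreeASp F n) a b p r)

abbrev AlgASp (F : Type) [Field F] (q : F) (n : ℕ) := RingQuot (ASpRel F q n)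

def sASp (F : Type) [Field F] (q : F) (n : ℕ) (r : ℕ) (i j : Fin (2 * n)) : AlgASp F q n :=
  RingQuot.mkAlgHom F (ASpRel F q n) (FreeAlgebra.ι F (Sum.inl (r, i, j)))

def sInvASp (F : Type) [Field F] (q : F) (n : ℕ) (k : Fin n) : AlgASp F q n :=
  RingQuot.mkAlgHom F (ASpRel F q n) (FreeAlgebra.ι F (Sum.inr k))

/-! q-antisymmetrizer and Sklyanin/quantum determinant machinery. -/

/-- The trigonometric R-matrix `R(u,v)`. -/
def Rtrig (F : Type) [Field F] (q : F) (N : ℕ) (u v : F) :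
    Matrix (Fin N × Fin N) (Fin N × Fin N) F := Matrix.of fun p r =>
  (if p = r then (if p.1 = p.2 then q⁻¹ * u - q * v else u - v) else 0)
  + (if p.1 = r.2 ∧ p.2 = r.1 ∧ p.1 ≠ p.2 then
      (q⁻¹ - q) * (if p.2 < p.1 then u else v) else 0)

/-- An operator on `ℂ^N ⊗ ℂ^N` acting in the `i`-th and `j`-th factors of `(ℂ^N)^{⊗ r}`. -/
def big2 (F : Type) [Field F] {N r : ℕ} (i j : Fin r)
    (M : Matrix (Fin N × Fin N) (Fin N × Fin N) F) :
    Matrix (Fin r → Fin N) (Fin r → Fin N) F :=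
  Matrix.of fun f g =>
    if ∀ k, k ≠ i → k ≠ j → f k = g k then M (f i, f j) (g i, g j) else 0

/-- The list of the pairs `(i,j)`, `i < j`, in lexicographic order. -/
def pairsLex (r : ℕ) : List (Fin r × Fin r) :=
  (List.finRange r).flatMap fun i =>
    ((List.finRange r).filter fun j => i < j).map fun j => (i, j)

/-- The number of inversions (the Coxeter length) of a permutation. -/
def invCount {r : ℕ} (σ : Equiv.Perm (Fin r)) : ℕ :=
  (Finset.univ.filter fun p : Fin r × Fin r => p.1 < p.2 ∧ σ p.2 < σ p.1).card

/-- The q-permutation operator `P^q` on `ℂ^N ⊗ ℂ^N`. -/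
def PqSmall (F : Type) [Field F] (q : F) (N : ℕ) :
    Matrix (Fin N × Fin N) (Fin N × Fin N) F := Matrix.of fun p r =>
  if r.1 = p.2 ∧ r.2 = p.1 then (if p.1 = p.2 then 1 else if p.2 < p.1 then q else q⁻¹)
  else 0

/-- The hypothesis that `Pq` is the extension of the q-permutation operators along
reduced decompositions: `P^q_{σ s_i} = P^q_σ P^q_{s_i}` whenever the length grows. -/
def PqExt (F : Type) [Field F] (q : F) (N r : ℕ)
    (Pq : Equiv.Perm (Fin r) → Matrix (Fin r → Fin N) (Fin r → Fin N) F) : Prop :=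
  Pq 1 = 1 ∧
    ∀ (σ : Equiv.Perm (Fin r)) (i : ℕ) (h : i + 1 < r),
      invCount (σ * Equiv.swap ⟨i, Nat.lt_of_succ_lt h⟩ ⟨i + 1, h⟩) = invCount σ + 1 →
        Pq (σ * Equiv.swap ⟨i, Nat.lt_of_succ_lt h⟩ ⟨i + 1, h⟩) =
          Pq σ * big2 F ⟨i, Nat.lt_of_succ_lt h⟩ ⟨i + 1, h⟩ (PqSmall F q N)

/-- The q-antisymmetrizer `A^q_r = Σ_σ sgn(σ) P^q_σ`. -/
def AqM (F : Type) [Field F] {N r : ℕ}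
    (Pq : Equiv.Perm (Fin r) → Matrix (Fin r → Fin N) (Fin r → Fin N) F) :
    Matrix (Fin r → Fin N) (Fin r → Fin N) F :=
  ∑ σ : Equiv.Perm (Fin r), ((Equiv.Perm.sign σ : ℤ) : F) • Pq σ

/-- A matrix acting in the `k`-th factor of `(ℂ^N)^{⊗ N}`, with entries in `A`. -/
def ampAt {A : Type} [Ring A] {N : ℕ} (k : Fin N) (M : Matrix (Fin N) (Fin N) A) :
    Matrix (Fin N → Fin N) (Fin N → Fin N) A :=
  Matrix.of fun f g => if ∀ l, l ≠ k → f l = g l then M (f k) (g k) else 0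

/-- A scalar two-site operator viewed over `A`, acting at sites `i`, `j`. -/
def big2A (F : Type) [Field F] {A : Type} [Ring A] [Algebra F A] {N : ℕ} (i j : Fin N)
    (M : Matrix (Fin N × Fin N) (Fin N × Fin N) F) :
    Matrix (Fin N → Fin N) (Fin N → Fin N) A :=
  (big2 F i j M).map (algebraMap F A)

/-- Coefficient of `u^m` in a product of formal series, each of which is supported in
degrees `≤ 1`; the series are given by their coefficient functions `ℤ → M`. -/
def seriesProdCoeff {M : Type} [Ring M] : List (ℤ → M) → ℤ → M
  | [], m => if m = 0 then 1 else 0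
  | c :: t, m => ∑ k ∈ Finset.Icc (m - t.length) 1, c k * seriesProdCoeff t (m - k)

/-! Series factors entering the Sklyanin determinant. -/

/-- The matrix `S^{(r)}` of the coefficients of `S(u)` (orthogonal case). -/
def SmatA (F : Type) [Field F] (q : F) (N : ℕ) (r : ℕ) :
    Matrix (Fin N) (Fin N) (UqAff F q N) :=
  Matrix.of fun i j => Scoef F q N r i j

/-- The series `S_k(q^{-2k+2} u)` acting at site `k` (0-based `k`), coefficientwise. -/
def SfacO (F : Type) [Field F] (q : F) (N : ℕ) (k : Fin N) (m : ℤ) :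
    Matrix (Fin N → Fin N) (Fin N → Fin N) (UqAff F q N) :=
  if m ≤ 0 then q ^ (2 * (k.val : ℤ) * (-m)) • ampAt k (SmatA F q N (-m).toNat) else 0

/-- The series `R_{ij}ᵗ((q^{-2i+2}u)⁻¹, q^{-2j+2}u)` (0-based `i`, `j`), coefficientwise. -/
def RtfacO (F : Type) [Field F] (q : F) (N : ℕ) (i j : Fin N) (m : ℤ) :
    Matrix (Fin N → Fin N) (Fin N → Fin N) (UqAff F q N) :=
  if m = -1 then q ^ (2 * (i.val : ℤ)) • big2A F i j (Rtilt F q N)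
  else if m = 1 then (-(q ^ (-2 * (j.val : ℤ)))) • big2A F i j (Rct F q N)
  else 0

/-- The ordered list of factors `S₁(u) R₁₂ᵗ ⋯ R₁Nᵗ S₂(q⁻²u) ⋯ S_N(q^{-2N+2}u)`. -/
def sdetFacsO (F : Type) [Field F] (q : F) (N : ℕ) :
    List (ℤ → Matrix (Fin N → Fin N) (Fin N → Fin N) (UqAff F q N)) :=
  (List.finRange N).flatMap fun i =>
    SfacO F q N i :: (((List.finRange N).filter fun j => i < j).map fun j => RtfacO F q N i j)

/-- The matrix `S^{(r)}` of the coefficients of `S(u)` (symplectic case). -/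
def SmatASp (F : Type) [Field F] (q : F) (n : ℕ) (r : ℕ) :
    Matrix (Fin (2 * n)) (Fin (2 * n)) (UqAff F q (2 * n)) :=
  Matrix.of fun i j => ScoefSp F q n r i j

def SfacSp (F : Type) [Field F] (q : F) (n : ℕ) (k : Fin (2 * n)) (m : ℤ) :
    Matrix (Fin (2 * n) → Fin (2 * n)) (Fin (2 * n) → Fin (2 * n)) (UqAff F q (2 * n)) :=
  if m ≤ 0 then q ^ (2 * (k.val : ℤ) * (-m)) • ampAt k (SmatASp F q n (-m).toNat) else 0

def sdetFacsSp (F : Type) [Field F] (q : F) (n : ℕ) :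
    List (ℤ → Matrix (Fin (2 * n) → Fin (2 * n)) (Fin (2 * n) → Fin (2 * n))
      (UqAff F q (2 * n))) :=
  (List.finRange (2 * n)).flatMap fun i =>
    SfacSp F q n i ::
      (((List.finRange (2 * n)).filter fun j => i < j).map fun j => RtfacO F q (2 * n) i j)

/-- Coefficientwise quantum determinant `qdet T(u)`:
the coefficient of `u^m` (nonzero only for `m ≤ 0`). -/
def qdetTc (F : Type) [Field F] (q : F) (N : ℕ) (m : ℤ) : UqAff F q N :=
  if m ≤ 0 then
    ∑ σ : Equiv.Perm (Fin N), ∑ rv ∈ Finset.Nat.antidiagonalTuple N (-m).toNat,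
      (((-q)⁻¹ ^ invCount σ) * ∏ k : Fin N, q ^ (2 * (k.val : ℤ) * (rv k : ℤ))) •
        ((List.finRange N).map fun k => tA F q N (rv k) (σ k) k).prod
  else 0

/-- Coefficientwise quantum determinant `qdet T̄(q^{2N-2} u⁻¹)`:
the coefficient of `u^m` (nonzero only for `m ≤ 0`). -/
def qdetTbc (F : Type) [Field F] (q : F) (N : ℕ) (m : ℤ) : UqAff F q N :=
  if m ≤ 0 then
    ∑ σ : Equiv.Perm (Fin N), ∑ rv ∈ Finset.Nat.antidiagonalTuple N (-m).toNat,
      (((-q)⁻¹ ^ invCount σ) *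
          ∏ k : Fin N, q ^ ((2 * (N : ℤ) - 2 - 2 * (k.val : ℤ)) * (rv k : ℤ))) •
        ((List.finRange N).map fun k => tbA F q N (rv k) (σ k) k).prod
  else 0

/-- The linear factor `q^{2i-2}u⁻¹ - q^{-2j+2}u` of `γ_N(u)` (0-based `i`, `j`),
viewed as an `A`-valued series. -/
def gamFac (F : Type) [Field F] (q : F) (N : ℕ) (p : Fin N × Fin N) (m : ℤ) : UqAff F q N :=
  if m = -1 then algebraMap F _ (q ^ (2 * (p.1.val : ℤ)))
  else if m = 1 then algebraMap F _ (-(q ^ (-2 * (p.2.val : ℤ)))) else 0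

/-- The list of series whose product is `γ_N(u) qdet T(u) qdet T̄(q^{2N-2}u⁻¹)`
in the orthogonal case. -/
def rhsO (F : Type) [Field F] (q : F) (N : ℕ) : List (ℤ → UqAff F q N) :=
  ((pairsLex N).map fun p => gamFac F q N p) ++ [qdetTc F q N, qdetTbc F q N]

theorem comp_swap_of_eq {ι n : Type*} [DecidableEq ι] {x : ι → n} {a b : ι} (h : x a = x b) :
    x ∘ Equiv.swap a b = x := by
  funext z
  by_cases ha : z = a
  · simp [ha, h]
  by_cases hb : z = b
  · simp [hb, h]
  simp [Equiv.swap_apply_of_ne_of_ne ha hb]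

section Braid

variable {K ι n M : Type*} [CommRing K] [DecidableEq ι] [LinearOrder n] [AddCommGroup M]
  [Module K M]

/-- The operator `R` acting on the arguments `a` and `b` of functions of several variables. -/
def braid (q q' : K) (a b : ι) : Module.End K ((ι → n) → M) where
  toFun g x := (if x a = x b then q else 1) • g x
    + (if x a < x b then q - q' else 0) • g (x ∘ Equiv.swap a b)
  map_add' f g := by
    funext x
    simp only [Pi.add_apply, smul_add]
    abel
  map_smul' c g := by
    funext x
    simp only [Pi.smul_apply, RingHom.id_apply, smul_add, smul_comm c]

theorem braid_apply (q q' : K) (a b : ι) (g : (ι → n) → M) (x : ι → n) :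
    braid q q' a b g x = (if x a = x b then q else 1) • g x
      + (if x a < x b then q - q' else 0) • g (x ∘ Equiv.swap a b) := rfl

theorem braid_mul_inverse {q q' : K} (hq : q * q' = 1) (a b : ι) :
    (braid q q' a b * braid q' q a b : Module.End K ((ι → n) → M)) = 1 := by
  ext g x
  have hs : (x ∘ Equiv.swap a b) ∘ Equiv.swap a b = x := by
    funext z
    simp
  simp only [Module.End.mul_apply, braid_apply, Function.comp_apply, Equiv.swap_apply_left,
    Equiv.swap_apply_right, hs, Module.End.one_apply]
  rcases lt_trichotomy (x a) (x b) with h | h | h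
  · simp only [h, h.ne, h.ne', h.not_gt, if_true, if_false]
    module
  · simp only [h, lt_irrefl, if_true, if_false, zero_smul, zero_mul, add_zero, smul_smul,
      hq, one_smul]
  · simp only [h, h.ne, h.ne', h.not_gt, if_true, if_false]
    module

theorem braid_commute (q q' r r' : K) {a b c d : ι} (hac : a ≠ c) (had : a ≠ d) (hbc : b ≠ c)
    (hbd : b ≠ d) :
    Commute (braid q q' a b : Module.End K ((ι → n) → M)) (braid r r' c d) := by
  ext g x
  have hs : (x ∘ Equiv.swap a b) ∘ Equiv.swap c d = (x ∘ Equiv.swap c d) ∘ Equiv.swap a b := by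
    funext z
    have : Disjoint ({a, b} : Set ι) {c, d} := by
      simp [hac.symm, had.symm, hbc.symm, hbd.symm]
    simp only [Function.comp_apply, Equiv.swap_apply_def]
    split_ifs <;> simp_all
  simp only [Module.End.mul_apply, braid_apply, Function.comp_apply, hs,
    Equiv.swap_apply_of_ne_of_ne hac had, Equiv.swap_apply_of_ne_of_ne hbc hbd,
    Equiv.swap_apply_of_ne_of_ne hac.symm hbc.symm, Equiv.swap_apply_of_ne_of_ne had.symm hbd.symm]
  module

theorem yang_baxter_scalar {q q' : K} (hq : q * q' = 1) (u v w : n) {g₀ g₁ g₂ g₃ g₄ g₅ : M}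
    (huv : u = v → g₁ = g₀ ∧ g₃ = g₄ ∧ g₂ = g₅) (hvw : v = w → g₂ = g₀ ∧ g₁ = g₄ ∧ g₃ = g₅)
    (huw : u = w → g₃ = g₀ ∧ g₂ = g₄ ∧ g₁ = g₅) :
    (if u = v then q else 1) •
          ((if u = w then q else 1) • ((if v = w then q else 1) • g₀ +
            (if v < w then q - q' else 0) • g₂) +
          (if u < w then q - q' else 0) • ((if v = u then q else 1) • g₃ +
            (if v < u then q - q' else 0) • g₄)) +
        (if u < v then q - q' else 0) •
          ((if v = w then q else 1) • ((if u = w then q else 1) • g₁ +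
            (if u < w then q - q' else 0) • g₅) +
          (if v < w then q - q' else 0) • ((if u = v then q else 1) • g₄ +
            (if u < v then q - q' else 0) • g₃)) =
      (if v = w then q else 1) •
          ((if u = w then q else 1) • ((if u = v then q else 1) • g₀ +
            (if u < v then q - q' else 0) • g₁) +
          (if u < w then q - q' else 0) • ((if w = v then q else 1) • g₃ +
            (if w < v then q - q' else 0) • g₅)) +
        (if v < w then q - q' else 0) •
          ((if u = v then q else 1) • ((if u = w then q else 1) • g₂ +
            (if u < w then q - q' else 0) • g₄) +
          (if u < v then q - q' else 0) • ((if v = w then q else 1) • g₅ +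
            (if v < w then q - q' else 0) • g₃)) := by
  rcases lt_trichotomy u v with h1 | h1 | h1 <;>
  rcases lt_trichotomy v w with h2 | h2 | h2 <;>
  rcases lt_trichotomy u w with h3 | h3 | h3 <;>
  try (exfalso; order)
  all_goals
    try (replace huv := huv h1; obtain ⟨rfl, rfl, rfl⟩ := huv)
    try (replace hvw := hvw h2; obtain ⟨rfl, rfl, rfl⟩ := hvw)
    try (replace huw := huw h3; obtain ⟨rfl, rfl, rfl⟩ := huw)
    try clear huv
    try clear hvw
    try clear huw
    try have h1' := h1.ne
    try have h1'' := h1.ne'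
    try have h1''' := h1.not_gt
    try have h2' := h2.ne
    try have h2'' := h2.ne'
    try have h2''' := h2.not_gt
    try have h3' := h3.ne
    try have h3'' := h3.ne'
    try have h3''' := h3.not_gt
    simp only [*, lt_irrefl, if_true, if_false]
    match_scalars
    all_goals try ring1
    all_goals first | linear_combination (q - q') * hq | linear_combination (q' - q) * hq

theorem braid_yang_baxter {q q' : K} (hq : q * q' = 1) {a b c : ι} (hab : a ≠ b) (hac : a ≠ c)
    (hbc : b ≠ c) :
    (braid q q' a b * braid q q' a c * braid q q' b c : Module.End K ((ι → n) → M))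
      = braid q q' b c * braid q q' a c * braid q q' a b := by
  ext g x
  have e1 : (x ∘ Equiv.swap a b) ∘ Equiv.swap a c = (x ∘ Equiv.swap b c) ∘ Equiv.swap a b := by
    funext z
    simp only [Function.comp_apply, Equiv.swap_apply_def]
    split_ifs <;> simp_all
  have e2 : (x ∘ Equiv.swap a c) ∘ Equiv.swap b c = (x ∘ Equiv.swap b c) ∘ Equiv.swap a b := by
    funext z
    simp only [Function.comp_apply, Equiv.swap_apply_def]
    split_ifs <;> simp_all
  have e3 : (x ∘ Equiv.swap a c) ∘ Equiv.swap a b = (x ∘ Equiv.swap a b) ∘ Equiv.swap b c := by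
    funext z
    simp only [Function.comp_apply, Equiv.swap_apply_def]
    split_ifs <;> simp_all
  have e4 : (x ∘ Equiv.swap b c) ∘ Equiv.swap a c = (x ∘ Equiv.swap a b) ∘ Equiv.swap b c := by
    funext z
    simp only [Function.comp_apply, Equiv.swap_apply_def]
    split_ifs <;> simp_all
  have e5 : ((x ∘ Equiv.swap b c) ∘ Equiv.swap a b) ∘ Equiv.swap b c = x ∘ Equiv.swap a c := by
    funext z
    simp only [Function.comp_apply, Equiv.swap_apply_def]
    split_ifs <;> simp_all
  have e6 : ((x ∘ Equiv.swap a b) ∘ Equiv.swap b c) ∘ Equiv.swap a b = x ∘ Equiv.swap a c := by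
    funext z
    simp only [Function.comp_apply, Equiv.swap_apply_def]
    split_ifs <;> simp_all
  simp only [Module.End.mul_apply, braid_apply, e1, e2, e3, e4, e5, e6]
  simp only [Function.comp_apply, Equiv.swap_apply_left, Equiv.swap_apply_right,
    Equiv.swap_apply_of_ne_of_ne hab hac,
    Equiv.swap_apply_of_ne_of_ne hab.symm hbc, Equiv.swap_apply_of_ne_of_ne hac.symm hbc.symm]
  refine yang_baxter_scalar hq _ _ _ (fun h => ?_) (fun h => ?_) (fun h => ?_)
  · rw [← e1, comp_swap_of_eq h]
    simp
  · rw [← e4, comp_swap_of_eq h]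
    simp
  · rw [← e2, ← e3, comp_swap_of_eq h]
    simp

variable (n) in
/-- The reflection equation for `s`, entrywise. -/
def IsReflection {A : Type*} [Ring A] [Algebra K A] (q q' : K) (s : n → n → A) : Prop :=
  ∀ i j k l : n,
    (if i = k then q else 1) • ((if j = k then q else 1) • (s i j * s k l)
        + (if j < k then q - q' else 0) • (s i k * s j l))
      + (if i < k then q - q' else 0) • ((if j = i then q else 1) • (s k j * s i l)
        + (if j < i then q - q' else 0) • (s k i * s j l))
    = (if l = j then q else 1) • ((if l = i then q else 1) • (s k l * s i j)
        + (if l < i then q - q' else 0) • (s k i * s l j))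
      + (if l < j then q - q' else 0) • ((if j = i then q else 1) • (s k j * s i l)
        + (if j < i then q - q' else 0) • (s k i * s j l))

/-- The coaction of the vector representation on solutions of the reflection equation. -/
def coact (q q' : K) (s : n → n → Module.End K M) (i j : n) : Module.End K (n → M) where
  toFun f p := (if p = i then q' else 1) • ((if j = p then q else 1) • s i j (f p)
      + (if j < p then q - q' else 0) • s i p (f j))
    + (if p < i then q' - q else 0) • ((if j = i then q else 1) • s p j (f i)
      + (if j < i then q - q' else 0) • s p i (f j))
  map_add' f g := by
    funext p
    simp only [Pi.add_apply, map_add]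
    module
  map_smul' c f := by
    funext p
    simp only [Pi.smul_apply, map_smul, RingHom.id_apply]
    module

theorem coact_apply (q q' : K) (s : n → n → Module.End K M) (i j : n) (f : n → M) (p : n) :
    coact q q' s i j f p = (if p = i then q' else 1) • ((if j = p then q else 1) • s i j (f p)
      + (if j < p then q - q' else 0) • s i p (f j))
    + (if p < i then q' - q else 0) • ((if j = i then q else 1) • s p j (f i)
      + (if j < i then q - q' else 0) • s p i (f j)) := rfl

theorem braid_yang_baxter_right {q q' : K} (hq : q * q' = 1) {a b c : ι} (hab : a ≠ b)
    (hac : a ≠ c) (hbc : b ≠ c) :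
    (braid q q' a c * braid q q' a b * braid q' q b c : Module.End K ((ι → n) → M))
      = braid q' q b c * braid q q' a b * braid q q' a c := by
  have hy := braid_yang_baxter (n := n) (M := M) hq hab hac hbc
  have h1 := braid_mul_inverse (n := n) (M := M) hq b c
  have h2 := braid_mul_inverse (n := n) (M := M) ((mul_comm q' q).trans hq) b c
  calc _ = braid q' q b c * (braid q q' b c * braid q q' a c * braid q q' a b)
        * braid q' q b c := by simp only [← mul_assoc, h2, one_mul]
    _ = _ := by simp only [← hy, mul_assoc, h1, mul_one]

theorem braid_yang_baxter_left {q q' : K} (hq : q * q' = 1) {a b c : ι} (hab : a ≠ b)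
    (hac : a ≠ c) (hbc : b ≠ c) :
    (braid q q' b c * braid q' q a b * braid q' q a c : Module.End K ((ι → n) → M))
      = braid q' q a c * braid q' q a b * braid q q' b c := by
  have hy := braid_yang_baxter (n := n) (M := M) hq hab hac hbc
  have h1 := braid_mul_inverse (n := n) (M := M) hq a b
  have h2 := braid_mul_inverse (n := n) (M := M) ((mul_comm q' q).trans hq) a b
  have h3 := braid_mul_inverse (n := n) (M := M) hq a c
  have h4 := braid_mul_inverse (n := n) (M := M) ((mul_comm q' q).trans hq) a c
  calc _ = braid q' q a c * braid q' q a b * (braid q q' a b * braid q q' a c * braid q q' b c)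
        * braid q' q a b * braid q' q a c := by
        simp only [mul_assoc]
        simp only [← mul_assoc, h2, h4, one_mul]
    _ = _ := by
      simp only [hy, mul_assoc]
      simp only [← mul_assoc, h1, h3, mul_one]

theorem braid_mul_intertwine {q q' : K} (hq : q * q' = 1) {i j k l p : ι}
    (hl : [i, j, k, l, p].Nodup) {g h : (ι → n) → M}
    (hgh : braid q q' i k (braid q q' j k g) = braid q q' l j (braid q q' l i h)) :
    braid q q' i k (braid q q' j k (braid q' q p i (braid q q' j p
        (braid q' q p k (braid q q' l p g)))))
      = braid q q' l j (braid q q' l i (braid q' q p k (braid q q' l p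
        (braid q' q p i (braid q q' j p h))))) := by
  simp only [List.nodup_cons, List.mem_cons, List.not_mem_nil, or_false, not_or, ← ne_eq] at hl
  obtain ⟨⟨ij, ik, il, ip⟩, ⟨jk, jl, jp⟩, ⟨kl, kp⟩, lp, -⟩ := hl
  have comm : ∀ {a b c d : ι} (r r' t t' : K), a ≠ c → a ≠ d → b ≠ c → b ≠ d →
      ∀ z : (ι → n) → M, braid r r' a b (braid t t' c d z) = braid t t' c d (braid r r' a b z) :=
    fun r r' t t' h1 h2 h3 h4 z =>
      LinearMap.congr_fun (braid_commute r r' t t' h1 h2 h3 h4).eq z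
  have left := LinearMap.congr_fun (braid_yang_baxter_left (n := n) (M := M) hq ip.symm kp.symm ik)
  have right₁ := LinearMap.congr_fun (braid_yang_baxter_right (n := n) (M := M) hq jp jk kp.symm)
  have right₂ := LinearMap.congr_fun
    (braid_yang_baxter_right (n := n) (M := M) hq lp (Ne.symm il) ip.symm)
  have yb := LinearMap.congr_fun (braid_yang_baxter (n := n) (M := M) hq jl.symm lp jp)
  simp only [Module.End.mul_apply] at left right₁ right₂ yb
  rw [comm q q' q' q jp ij.symm kp ik.symm, right₁, left, comm q q' q q' jl jp kl kp,
    comm q q' q q' ij ip jk.symm kp, comm q q' q q' il ip kl kp, hgh,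
    comm q q' q' q lp kl.symm ip ik, comm q q' q' q lp kl.symm jp jk, right₂,
    comm q q' q' q lp il.symm jp ij.symm, comm q q' q q' jl.symm lp ij ip, yb]

theorem IsReflection.coact {q q' : K} (hq : q * q' = 1) {s : n → n → Module.End K M}
    (hs : IsReflection n q q' s) : IsReflection n q q' (coact q q' s) := by
  intro i j k l
  ext1 f
  funext p
  let G : (Fin 5 → n) → M := fun x => s (x 0) (x 1) (s (x 2) (x 3) (f (x 4)))
  let H : (Fin 5 → n) → M := fun x => s (x 2) (x 3) (s (x 0) (x 1) (f (x 4)))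
  have hG : braid q' q 4 0 (braid q q' 1 4 (braid q' q 4 2 (braid q q' 3 4 G)))
      = fun x => _root_.coact q q' s (x 0) (x 1) (_root_.coact q q' s (x 2) (x 3) f) (x 4) := by
    funext x
    simp [G, braid_apply, coact_apply, Equiv.swap_apply_def, -ite_smul]
  have hH : braid q' q 4 2 (braid q q' 3 4 (braid q' q 4 0 (braid q q' 1 4 H)))
      = fun x => _root_.coact q q' s (x 2) (x 3) (_root_.coact q q' s (x 0) (x 1) f) (x 4) := by
    funext x
    simp [H, braid_apply, coact_apply, Equiv.swap_apply_def, -ite_smul]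
  have hGH : braid q q' 0 2 (braid q q' 1 2 G) = braid q q' 3 1 (braid q q' 3 0 H) := by
    funext x
    have := LinearMap.congr_fun (hs (x 0) (x 1) (x 2) (x 3)) (f (x 4))
    simp only [LinearMap.add_apply, LinearMap.smul_apply, Module.End.mul_apply] at this
    simpa [G, H, braid_apply, Equiv.swap_apply_def] using this
  have key := congrFun (braid_mul_intertwine hq (i := 0) (j := 1) (k := 2) (l := 3)
    (p := 4) (by decide) hGH) ![i, j, k, l, p]
  rw [hG, hH] at key
  simp only [LinearMap.add_apply, Pi.add_apply, LinearMap.smul_apply, Pi.smul_apply,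
    Module.End.mul_apply]
  simp only [braid_apply, Equiv.swap_apply_def, Function.comp_apply, Fin.reduceEq, if_true,
    if_false] at key
  exact key
end Braid

section Coaction
open Module

variable {K n M : Type*} [CommRing K] [LinearOrder n] [AddCommGroup M] [Module K M]

theorem isReflection_one {A : Type*} [Ring A] [Algebra K A] (q q' : K) :
    IsReflection n q q' (fun i j => if i = j then (1 : A) else 0) := by
  intro i j k l
  by_cases h1 : i = j
  · subst h1
    by_cases h2 : k = l
    · subst h2
      rcases lt_trichotomy i k with h | rfl | h
      · simp [h.ne, h.ne', h, h.not_gt]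
      · simp
      · simp [h.ne, h.ne', h, h.not_gt]
    · rcases eq_or_ne i k with rfl | h3
      · simp [h2, Ne.symm h2]
      · rcases eq_or_ne i l with rfl | h4
        · simp [h2, Ne.symm h2]
        · simp [h2, h3, h3.symm, h4, Ne.symm h4]
  · by_cases h2 : i = k
    · subst h2
      by_cases h3 : j = l
      · subst h3
        rcases lt_or_gt_of_ne h1 with h | h <;> simp [h, h1, Ne.symm h1, h.not_gt]
      · rcases eq_or_ne i l with rfl | h4
        · simp [h1, Ne.symm h1]
        · simp [h1, Ne.symm h1, h3, Ne.symm h3, h4]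
    · rcases eq_or_ne j k with rfl | h3
      · rcases eq_or_ne i l with rfl | h4
        · rcases lt_or_gt_of_ne h1 with h | h <;> simp [h1, Ne.symm h1]
        · simp [h1, Ne.symm h1, h4]
      · simp [h1, Ne.symm h1, h2, Ne.symm h2, h3, Ne.symm h3]

variable {q q' : K} {s : n → n → End K M}

theorem coact_of_lt (h₀ : ∀ i j, i < j → s i j = 0) {i j : n} (hij : i < j) :
    coact q q' s i j = 0 := by
  ext1 f
  funext p
  have h1 : j < p → s i p = 0 := fun h => h₀ _ _ (hij.trans h)
  have h2 : p < i → s p j = 0 := fun h => h₀ _ _ (h.trans hij)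
  simp only [coact_apply, h₀ i j hij, hij.ne', hij.not_gt]
  split_ifs <;> simp_all

theorem coact_self (hq : q * q' = 1) (h₀ : ∀ i j, i < j → s i j = 0) (h₁ : ∀ i, s i i = 1)
    (i : n) : coact q q' s i i = 1 := by
  ext1 f
  funext p
  have h1 : i < p → s i p = 0 := fun h => h₀ _ _ h
  have h2 : p < i → s p i = 0 := fun h => h₀ _ _ h
  have h3 : q' * q = 1 := by rw [mul_comm, hq]
  simp only [coact_apply, h₁, lt_irrefl, eq_comm (a := i)]
  split_ifs <;> simp_all [smul_smul]

/-- The operator `E i j - E j i` on `n → M`. -/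
def skewUnit (i j : n) : End K (n → M) where
  toFun f p := (if p = i then (1 : K) else 0) • f j - (if p = j then (1 : K) else 0) • f i
  map_add' f g := by
    funext p
    simp only [Pi.add_apply]
    module
  map_smul' c f := by
    funext p
    simp only [Pi.smul_apply, RingHom.id_apply]
    module

/-- The part of higher order at `q = 1` of the coaction on the rescaled generators. -/
def coactTail (q' : K) (Y : n → n → End K M) (i j : n) : End K (n → M) where
  toFun f p := (if p = j then (1 : K) else 0) • Y i j (f p)
    - (if p = i then q' else 0) • (Y i j (f p) + f j)
    + (if j < p ∧ p < i then 1 + q' else 0) • (Y i p (f j) - Y p j (f i))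
  map_add' f g := by
    funext p
    simp only [Pi.add_apply, map_add]
    module
  map_smul' c f := by
    funext p
    simp only [Pi.smul_apply, map_smul, RingHom.id_apply]
    module

theorem coact_of_gt (hq : q * q' = 1) (h₀ : ∀ i j, i < j → s i j = 0) (h₁ : ∀ i, s i i = 1)
    {Y : n → n → End K M} (hY : ∀ i j, j < i → s i j = (q - q') • Y i j) {i j : n} (hij : j < i) :
    coact q q' s i j
      = (q - q') • ((Y i j).compLeft n + skewUnit i j + (q - 1) • coactTail q' Y i j) := by
  ext1 f
  funext p
  simp only [coact_apply, LinearMap.smul_apply, Pi.smul_apply, LinearMap.add_apply, Pi.add_apply,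
    LinearMap.compLeft_apply, skewUnit, coactTail, LinearMap.coe_mk, AddHom.coe_mk,
    Function.comp_apply, hY i j hij, hij.ne]
  rcases lt_trichotomy p i with hp | rfl | hp
  · rcases lt_trichotomy p j with hj | rfl | hj
    · simp only [hp, hp.ne, hj.not_gt, hj.ne, hj.ne', hij, h₀ _ _ hp, h₀ _ _ hj]
      simp
    · simp only [hp, hp.ne, h₁, lt_irrefl, h₀ _ _ hp]
      simp
      module
    · simp only [hp, hp.ne, hj, hj.ne, hj.ne', hij, h₀ _ _ hp, hY _ _ hp, hY _ _ hj]
      simp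
      match_scalars
      · ring
      · linear_combination (q' - q) * hq
      · linear_combination (q - q') * hq
  · simp only [hij, hij.ne, hij.ne', h₁, lt_irrefl]
    simp
    match_scalars
    · linear_combination (q - q') * hq
    · linear_combination (q - q') * hq
  · simp only [hp.not_gt, hp.ne', hij.trans hp, (hij.trans hp).ne, (hij.trans hp).ne', h₀ _ _ hp]
    simp

end Coaction

section MatrixAction
open Module

variable {K n M : Type} [CommRing K] [Fintype n] [AddCommGroup M] [Module K M]

/-- A scalar matrix acting on `n → M`. -/
def matrixAct (A : Matrix n n K) : End K (n → M) where
  toFun f p := ∑ r, A p r • f r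
  map_add' f g := by
    funext p
    simp [smul_add, Finset.sum_add_distrib]
  map_smul' c f := by
    funext p
    simp [Finset.smul_sum, smul_comm c]

theorem matrixAct_apply (A : Matrix n n K) (f : n → M) (p : n) :
    matrixAct A f p = ∑ r, A p r • f r := rfl

theorem matrixAct_mul (A B : Matrix n n K) :
    (matrixAct (A * B) : End K (n → M)) = matrixAct A * matrixAct B := by
  ext1 f
  funext p
  simp only [Module.End.mul_apply, matrixAct_apply, Matrix.mul_apply, Finset.sum_smul,
    Finset.smul_sum, smul_smul]
  exact Finset.sum_comm

theorem matrixAct_commute (A : Matrix n n K) (T : End K M) :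
    Commute (matrixAct A) (T.compLeft n) := by
  ext1 f
  funext p
  simp [matrixAct_apply]

end MatrixAction

section Functional
open Module

variable {K n M : Type} [CommRing K] [LinearOrder n] [Fintype n] [AddCommGroup M] [Module K M]

theorem matrixAct_one : (matrixAct 1 : End K (n → M)) = 1 := by
  refine LinearMap.ext fun f => funext fun p => ?_
  simp [matrixAct_apply, Matrix.one_apply]

theorem skewUnit_eq_matrixAct (i j : n) :
    (skewUnit i j : End K (n → M)) = matrixAct (Matrix.single i j 1 - Matrix.single j i 1) := by
  refine LinearMap.ext fun f => funext fun p => ?_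
  simp [matrixAct_apply, skewUnit, Matrix.single_apply, sub_smul, Finset.sum_sub_distrib,
    ite_and, eq_comm (a := p)]

/-- Pairing of the lower triangular blocks of an operator on `n → M` with a functional. -/
def lowerPairing (t : n → n → K) (Φ : End K M →ₗ[K] K) : End K (n → M) →ₗ[K] K where
  toFun Z := ∑ a, ∑ b, if b < a then
    t a b * Φ (LinearMap.proj a ∘ₗ Z ∘ₗ LinearMap.single K (fun _ => M) b) else 0
  map_add' Y Z := by
    simp only [← Finset.sum_add_distrib]
    refine Finset.sum_congr rfl fun a _ => Finset.sum_congr rfl fun b _ => ?_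
    split_ifs
    · rw [LinearMap.add_comp, LinearMap.comp_add, map_add, mul_add]
    · simp
  map_smul' c Z := by
    simp only [RingHom.id_apply, smul_eq_mul, Finset.mul_sum]
    refine Finset.sum_congr rfl fun a _ => Finset.sum_congr rfl fun b _ => ?_
    split_ifs
    · rw [LinearMap.smul_comp, LinearMap.comp_smul, map_smul, smul_eq_mul, mul_left_comm]
    · simp

theorem lowerPairing_compLeft_mul_matrixAct (t : n → n → K) (Φ : End K M →ₗ[K] K) (T : End K M)
    (A : Matrix n n K) : lowerPairing t Φ (T.compLeft n * matrixAct A)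
      = (∑ a, ∑ b, if b < a then t a b * A a b else 0) * Φ T := by
  have h : ∀ a b, LinearMap.proj a ∘ₗ (T.compLeft n * matrixAct A) ∘ₗ
      LinearMap.single K (fun _ => M) b = A a b • T := by
    intro a b
    ext m
    simp [matrixAct_apply, Pi.single_apply]
  simp only [lowerPairing, LinearMap.coe_mk, AddHom.coe_mk, h, map_smul, smul_eq_mul,
    Finset.sum_mul]
  refine Finset.sum_congr rfl fun a _ => Finset.sum_congr rfl fun b _ => ?_
  split_ifs
  · ring
  · simp

theorem sum_lower_single (t : n → n → K) {i j : n} (hij : j < i) :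
    (∑ a, ∑ b, if b < a then
      t a b * (Matrix.single i j 1 - Matrix.single j i (1 : K) : Matrix n n K) a b else 0)
      = t i j := by
  have h : ∀ a b : n, (if b < a then
      t a b * (Matrix.single i j 1 - Matrix.single j i (1 : K) : Matrix n n K) a b else 0)
      = if i = a then (if j = b then t a b else 0) else 0 := by
    intro a b
    simp only [Matrix.sub_apply, Matrix.single_apply]
    by_cases hi : i = a
    · subst hi
      by_cases hj : j = b
      · subst hj
        simp [hij, hij.ne]
      · simp [hj, hij.ne]
    · have : b < a → ¬ (j = a ∧ i = b) := by
        rintro h ⟨rfl, rfl⟩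
        order
      split_ifs <;> simp_all
  simp only [h]
  simp

theorem sum_lower_one (t : n → n → K) :
    (∑ a, ∑ b, if b < a then t a b * (1 : Matrix n n K) a b else 0) = 0 := by
  refine Finset.sum_eq_zero fun a _ => Finset.sum_eq_zero fun b _ => ?_
  split_ifs with h
  · simp [h.ne']
  · rfl


variable {κ : Type} [CommRing κ] {ρ : K →+* κ} {t : n → n → K} {Φ : End K M →ₗ[K] K}
  {Y : n → n → End K M} {m : ℕ} {c : κ}

theorem lowerPairing_prod_matrixAct
    (hΦ : ∀ L : List {p : n × n // p.2 < p.1}, L.length ≤ m →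
      ρ (Φ (L.map fun g => Y g.1.1 g.1.2).prod) = if L.length = m then
        c * (L.map fun g => ρ (t g.1.1 g.1.2)).prod else 0)
    (L L₀ : List {p : n × n // p.2 < p.1}) (A : Matrix n n K) (hL : L₀.length + L.length ≤ m) :
    ρ (lowerPairing t Φ ((L₀.map fun g => Y g.1.1 g.1.2).prod.compLeft n * matrixAct A *
        (L.map fun g => (Y g.1.1 g.1.2).compLeft n + skewUnit g.1.1 g.1.2).prod))
      = if L₀.length + L.length = m then
          c * ((L₀.map fun g => ρ (t g.1.1 g.1.2)).prod * (L.map fun g => ρ (t g.1.1 g.1.2)).prod)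
            * ρ (∑ a, ∑ b, if b < a then t a b * A a b else 0) else 0 := by
  induction L generalizing L₀ A with
  | nil =>
    simp only [List.length_nil, add_zero] at hL
    simp only [List.map_nil, List.prod_nil, mul_one, lowerPairing_compLeft_mul_matrixAct, map_mul,
      hΦ L₀ hL, List.length_nil, add_zero]
    split_ifs <;> ring
  | cons g L ih =>
    simp only [List.length_cons] at hL
    have h1 := ih (L₀ ++ [g]) A (by simp; omega)
    have h2 := ih L₀ (A * (Matrix.single g.1.1 g.1.2 1 - Matrix.single g.1.2 g.1.1 1)) (by omega)
    rw [if_neg (by omega)] at h2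
    have hX : ∀ S : End K M, ∀ Z : End K (n → M), S.compLeft n * matrixAct A *
        (((Y g.1.1 g.1.2).compLeft n + skewUnit g.1.1 g.1.2) * Z)
        = (S * Y g.1.1 g.1.2).compLeft n * matrixAct A * Z + S.compLeft n *
          matrixAct (A * (Matrix.single g.1.1 g.1.2 1 - Matrix.single g.1.2 g.1.1 1)) * Z := by
      intro S Z
      have hS : (S * Y g.1.1 g.1.2).compLeft n = S.compLeft n * (Y g.1.1 g.1.2).compLeft n := rfl
      rw [hS, matrixAct_mul, ← skewUnit_eq_matrixAct, mul_assoc (S.compLeft n),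
        mul_assoc (S.compLeft n) ((Y g.1.1 g.1.2).compLeft n),
        ← (matrixAct_commute A (Y g.1.1 g.1.2)).eq]
      noncomm_ring
    rw [List.map_cons, List.prod_cons, hX, map_add, map_add, h2, add_zero]
    simp only [List.map_append, List.map_cons, List.map_nil, List.prod_append, List.prod_nil,
      mul_one,
      List.length_append, List.length_cons, List.length_nil, zero_add, List.prod_cons] at h1 ⊢
    rw [h1]
    simp only [add_assoc, add_comm 1, mul_assoc]

theorem lowerPairing_prod
    (hΦ : ∀ L : List {p : n × n // p.2 < p.1}, L.length ≤ m →
      ρ (Φ (L.map fun g => Y g.1.1 g.1.2).prod) = if L.length = m then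
        c * (L.map fun g => ρ (t g.1.1 g.1.2)).prod else 0)
    (L L₀ : List {p : n × n // p.2 < p.1}) (hL : L₀.length + L.length ≤ m + 1) :
    ρ (lowerPairing t Φ ((L₀.map fun g => Y g.1.1 g.1.2).prod.compLeft n *
        (L.map fun g => (Y g.1.1 g.1.2).compLeft n + skewUnit g.1.1 g.1.2).prod))
      = if L₀.length + L.length = m + 1 then
          L.length * c *
            ((L₀.map fun g => ρ (t g.1.1 g.1.2)).prod * (L.map fun g => ρ (t g.1.1 g.1.2)).prod)
          else 0 := by
  induction L generalizing L₀ with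
  | nil =>
    have := lowerPairing_compLeft_mul_matrixAct t Φ (L₀.map fun g => Y g.1.1 g.1.2).prod 1
    rw [matrixAct_one, sum_lower_one, zero_mul, mul_one] at this
    simp [this]
  | cons g L ih =>
    simp only [List.length_cons] at hL
    have h1 := ih (L₀ ++ [g]) (by simp; omega)
    have h2 := lowerPairing_prod_matrixAct hΦ L L₀
      (Matrix.single g.1.1 g.1.2 1 - Matrix.single g.1.2 g.1.1 1) (by omega)
    rw [sum_lower_single t g.2, ← skewUnit_eq_matrixAct] at h2
    have hX : ∀ S : End K M, ∀ Z : End K (n → M), S.compLeft n *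
        (((Y g.1.1 g.1.2).compLeft n + skewUnit g.1.1 g.1.2) * Z)
        = (S * Y g.1.1 g.1.2).compLeft n * Z + S.compLeft n * skewUnit g.1.1 g.1.2 * Z := by
      intro S Z
      have hS : (S * Y g.1.1 g.1.2).compLeft n = S.compLeft n * (Y g.1.1 g.1.2).compLeft n := rfl
      rw [hS]
      noncomm_ring
    rw [List.map_cons, List.prod_cons, hX, map_add, map_add, h2]
    simp only [List.map_append, List.map_cons, List.map_nil, List.prod_append, List.prod_nil,
      mul_one,
      List.length_append, List.length_cons, List.length_nil, zero_add, List.prod_cons] at h1 ⊢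
    rw [h1]
    have e : (L₀.length + L.length = m) ↔ (L₀.length + 1 + L.length = m + 1) := by omega
    simp only [e, ← add_assoc, add_right_comm _ L.length 1]
    split_ifs
    · push_cast
      ring
    · simp

theorem map_prod_congr {R A B : Type*} [CommRing R] [CommRing B] [Ring A] [Algebra R A]
    {ρ : R →+* B} {u : R} (hu : ρ u = 0) (Ψ : A →ₗ[R] R) {γ : Type*} (a b z : γ → A)
    (h : ∀ g, a g = b g + u • z g) (L : List γ) :
    ρ (Ψ (L.map a).prod) = ρ (Ψ (L.map b).prod) := by
  have : ∃ w, (L.map a).prod = (L.map b).prod + u • w := by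
    induction L with
    | nil => exact ⟨0, by simp⟩
    | cons g L ih =>
      obtain ⟨w, hw⟩ := ih
      refine ⟨b g * w + z g * (L.map b).prod + u • (z g * w), ?_⟩
      simp only [List.map_cons, List.prod_cons, h, hw, add_mul, mul_add, smul_mul_assoc,
        mul_smul_comm, smul_add]
      abel
  obtain ⟨w, hw⟩ := this
  simp [hw, hu]

variable (ρ) in
theorem exists_reflection_functional {q q' : K} (hq : q * q' = 1) (hρ : ρ q = 1) (t : n → n → K)
    (m : ℕ) : ∃ (M : Type) (_ : AddCommGroup M) (_ : Module K M) (s Y : n → n → End K M)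
      (Φ : End K M →ₗ[K] K), IsReflection n q q' s ∧ (∀ i j, i < j → s i j = 0) ∧
      (∀ i, s i i = 1) ∧ (∀ i j, j < i → s i j = (q - q') • Y i j) ∧
      ∀ L : List {p : n × n // p.2 < p.1}, L.length ≤ m →
        ρ (Φ (L.map fun g => Y g.1.1 g.1.2).prod) = if L.length = m then
          (m.factorial : κ) * (L.map fun g => ρ (t g.1.1 g.1.2)).prod else 0 := by
  induction m with
  | zero =>
    refine ⟨K, inferInstance, inferInstance, fun i j => if i = j then 1 else 0, 0,
      LinearMap.applyₗ 1, isReflection_one q q', fun i j h => by simp [h.ne], fun i => by simp,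
      fun i j h => by simp [h.ne'], fun L hL => ?_⟩
    obtain rfl := List.length_eq_zero_iff.mp (Nat.le_zero.mp hL)
    simp
  | succ m ih =>
    obtain ⟨M, _, _, s, Y, Φ, hs, h₀, h₁, hY, hΦ⟩ := ih
    refine ⟨n → M, inferInstance, inferInstance, coact q q' s, fun i j =>
      (Y i j).compLeft n + skewUnit i j + (q - 1) • coactTail q' Y i j, lowerPairing t Φ,
      hs.coact hq, fun i j => coact_of_lt h₀, coact_self hq h₀ h₁,
      fun i j => coact_of_gt hq h₀ h₁ hY, fun L hL => ?_⟩
    rw [map_prod_congr (by simp [hρ]) (lowerPairing t Φ) _ _ _ (fun g => rfl)]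
    have := lowerPairing_prod hΦ L [] (by simpa using hL)
    simp only [List.map_nil, List.prod_nil, List.length_nil, zero_add, one_mul] at this
    refine Eq.trans ?_ (this.trans ?_)
    · congr 2
    · split_ifs with h
      · rw [h, Nat.factorial_succ]
        push_cast
        ring
      · rfl

end Functional

section Independence
open Module

theorem IsReflection.baseChange {K F A n : Type*} [CommRing K] [CommRing F] [Algebra K F] [Ring A]
    [Algebra K A] [LinearOrder n] {q q' : K} {s : n → n → A} (hs : IsReflection n q q' s) :
    IsReflection n (algebraMap K F q) (algebraMap K F q')
      (fun i j => (1 : F) ⊗ₜ[K] s i j : n → n → F ⊗[K] A) := by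
  intro i j k l
  have := congrArg (fun a => (1 : F) ⊗ₜ[K] a) (hs i j k l)
  simp only [← map_sub, ← map_zero (algebraMap K F), ← map_one (algebraMap K F), ← apply_ite,
    algebraMap_smul, Algebra.TensorProduct.tmul_mul_tmul, ← TensorProduct.tmul_smul,
    ← TensorProduct.tmul_add]
  simpa using this

variable {F n A : Type} [Field F] [LinearOrder n] [Fintype n] [Ring A] [Algebra F A]
  (V : ValuationSubring F)

theorem exists_lower_triangular_functional {q q' : V} (hq : q * q' = 1)
    (hq1 : IsLocalRing.residue V q = 1) {sA : n → n → A}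
    (hA : ∀ (B : Type) [Ring B] [Algebra F B] (s : n → n → B), IsReflection n (q : F) (q' : F) s →
      (∀ i j, i < j → s i j = 0) → (∀ i, s i i = 1) → ∃ f : A →ₐ[F] B, ∀ i j, f (sA i j) = s i j)
    (t : {p : n × n // p.2 < p.1} → IsLocalRing.ResidueField V) (m : ℕ) :
    ∃ (Ψ : A →ₗ[F] F) (Θ : List {p : n × n // p.2 < p.1} → V),
      (∀ L, Ψ (L.map fun g => sA g.1.1 g.1.2).prod = ((q : F) - q') ^ L.length * Θ L) ∧
      ∀ L, L.length ≤ m → IsLocalRing.residue V (Θ L) =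
        if L.length = m then (m.factorial : IsLocalRing.ResidueField V) * (L.map t).prod
        else 0 := by
  choose T hT using fun g => IsLocalRing.residue_surjective (R := V) (t g)
  obtain ⟨M, _, _, s, Y, Φ, hs, h₀, h₁, hY, hΦ⟩ := exists_reflection_functional
    (IsLocalRing.residue V) hq hq1 (fun i j : n => if h : j < i then T ⟨(i, j), h⟩ else 0) m
  obtain ⟨f, hf⟩ := hA (F ⊗[V] End V M) (fun i j => 1 ⊗ₜ s i j) hs.baseChange
    (fun i j h => by simp [h₀ i j h])
    (fun i => by simp [h₁ i, Algebra.TensorProduct.one_def])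
  refine ⟨(TensorProduct.AlgebraTensorModule.rid V F F).toLinearMap ∘ₗ Φ.baseChange F ∘ₗ
    f.toLinearMap, fun L => Φ (L.map fun g => Y g.1.1 g.1.2).prod, fun L => ?_, fun L hL => ?_⟩
  · have : f (L.map fun g => sA g.1.1 g.1.2).prod
        = ((q : F) - q') ^ L.length • 1 ⊗ₜ[V] (L.map fun g => Y g.1.1 g.1.2).prod := by
      induction L with
      | nil => simp [Algebra.TensorProduct.one_def]
      | cons g L ih =>
        have e : (1 : F) ⊗ₜ[V] ((q - q') • Y g.1.1 g.1.2)
            = ((q : F) - q') • (1 : F) ⊗ₜ[V] (Y g.1.1 g.1.2) := by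
          rw [TensorProduct.tmul_smul, ← algebraMap_smul F (q - q')]
          rfl
        rw [List.map_cons, List.prod_cons, map_mul, ih, hf, hY _ _ g.2, e, smul_mul_smul_comm,
          Algebra.TensorProduct.tmul_mul_tmul, ← pow_succ', one_mul, List.length_cons,
          List.map_cons,
          List.prod_cons]
    simp [this, Algebra.smul_def, ValuationSubring.algebraMap_apply]
  · rw [hΦ L hL]
    have : (fun g : {p : n × n // p.2 < p.1} => IsLocalRing.residue V
        (if h : g.1.2 < g.1.1 then T ⟨(g.1.1, g.1.2), h⟩ else 0)) = t := by
      funext g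
      rw [dif_pos g.2]
      exact hT g
    rw [this]

theorem MvPolynomial.prod_map_X {σ R : Type*} [DecidableEq σ] [CommSemiring R] (L : List σ) :
    (L.map (MvPolynomial.X : σ → MvPolynomial σ R)).prod
      = MvPolynomial.monomial (Multiset.toFinsupp (L : Multiset σ)) 1 := by
  induction L with
  | nil => simp
  | cons g L ih =>
    rw [List.map_cons, List.prod_cons, ih, MvPolynomial.X, MvPolynomial.monomial_mul, one_mul,
      ← Multiset.cons_coe, ← Multiset.singleton_add, map_add, Multiset.toFinsupp_singleton]

theorem linearIndependent_lower_monomials [CharZero (IsLocalRing.ResidueField V)] {q q' : V}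
    (hq : q * q' = 1) (hqq : q ≠ q')
    (hq1 : IsLocalRing.residue V q = 1) {sA : n → n → A}
    (hA : ∀ (B : Type) [Ring B] [Algebra F B] (s : n → n → B), IsReflection n (q : F) (q' : F) s →
      (∀ i j, i < j → s i j = 0) → (∀ i, s i i = 1) → ∃ f : A →ₐ[F] B, ∀ i j, f (sA i j) = s i j)
    {κ : Type} (w : κ → List {p : n × n // p.2 < p.1})
    (hw : Function.Injective fun k => (w k : Multiset {p : n × n // p.2 < p.1})) :
    LinearIndependent F (fun k => ((w k).map fun g => sA g.1.1 g.1.2).prod) := by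
  classical
  rw [linearIndependent_iff]
  intro l hl
  by_contra hne
  have hh : (q : F) - q' ≠ 0 := sub_ne_zero.mpr fun h => hqq (Subtype.ext h)
  let c : κ → F := fun k => l k * ((q : F) - q') ^ (w k).length
  obtain ⟨k₀, hk₀, hmax⟩ := l.support.exists_max_image (fun k => V.valuation (c k))
    (Finsupp.support_nonempty_iff.mpr hne)
  have hc₀ : c k₀ ≠ 0 := mul_ne_zero (Finsupp.mem_support_iff.mp hk₀) (pow_ne_zero _ hh)
  have hmem : ∀ k ∈ l.support, c k / c k₀ ∈ V := by
    intro k hk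
    rw [← ValuationSubring.valuation_le_one_iff, map_div₀]
    exact div_le_one_of_le₀ (hmax k hk) zero_le
  let e : κ → V := fun k => if h : k ∈ l.support then ⟨c k / c k₀, hmem k h⟩ else 0
  have he : ∀ k ∈ l.support, (e k : F) = c k / c k₀ := fun k hk => by simp only [e, dif_pos hk]
  have he₀ : e k₀ = 1 := Subtype.ext (by rw [he k₀ hk₀, div_self hc₀]; rfl)
  obtain ⟨k₁, hk₁, hlen⟩ :=
    (l.support.filter fun k => IsLocalRing.residue V (e k) ≠ 0).exists_max_image
    (fun k => (w k).length) ⟨k₀, by simp only [Finset.mem_filter, hk₀, he₀, map_one]; simp⟩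
  rw [Finset.mem_filter] at hk₁
  set m := (w k₁).length
  let P : MvPolynomial {p : n × n // p.2 < p.1} (IsLocalRing.ResidueField V) :=
    ∑ k ∈ l.support, if (w k).length = m then
      MvPolynomial.C (IsLocalRing.residue V (e k)) * ((w k).map MvPolynomial.X).prod else 0
  have hP : P = 0 := by
    refine MvPolynomial.funext fun t => ?_
    obtain ⟨Ψ, Θ, hΨ, hΘ⟩ := exists_lower_triangular_functional V hq hq1 hA t m
    have h1 : ∑ k ∈ l.support, e k * Θ (w k) = 0 := by
      refine Subtype.ext ?_
      have h2 := congrArg Ψ hl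
      rw [Finsupp.linearCombination_apply, Finsupp.sum, map_sum, map_zero] at h2
      rw [AddSubmonoidClass.coe_finsetSum]
      refine mul_left_cancel₀ hc₀ (Eq.trans ?_ (h2.trans (mul_zero _).symm))
      rw [Finset.mul_sum]
      refine Finset.sum_congr rfl fun k hk => ?_
      rw [map_smul, hΨ, MulMemClass.coe_mul, he k hk, smul_eq_mul]
      rw [← mul_assoc, mul_div_cancel₀ _ hc₀]
      simp only [c]
      ring
    have h3 := congrArg (IsLocalRing.residue V) h1
    rw [map_sum, map_zero] at h3
    have h4 : (m.factorial : IsLocalRing.ResidueField V) * MvPolynomial.eval t P = 0 := by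
      rw [← h3, map_sum, Finset.mul_sum]
      refine Finset.sum_congr rfl fun k hk => ?_
      rw [map_mul]
      rcases le_or_gt (w k).length m with h | h
      · rw [hΘ _ h]
        split_ifs
        · rw [map_mul, MvPolynomial.eval_C, map_list_prod, List.map_map]
          have : (MvPolynomial.eval t ∘ MvPolynomial.X) = t := by
            funext g
            simp
          rw [this]
          ring
        · simp
      · rw [if_neg h.ne', map_zero, mul_zero]
        by_cases hr : IsLocalRing.residue V (e k) = 0
        · rw [hr, zero_mul]
        · exact absurd (hlen k (Finset.mem_filter.mpr ⟨hk, hr⟩)) h.not_ge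
    rw [map_zero]
    exact (mul_eq_zero.mp h4).resolve_left (Nat.cast_ne_zero.mpr m.factorial_ne_zero)
  have hcoeff := congrArg (MvPolynomial.coeff (Multiset.toFinsupp (w k₁ : Multiset _))) hP
  rw [MvPolynomial.coeff_zero, MvPolynomial.coeff_sum, Finset.sum_eq_single_of_mem k₁ hk₁.1,
    if_pos rfl, MvPolynomial.coeff_C_mul, MvPolynomial.prod_map_X, MvPolynomial.coeff_monomial,
    if_pos rfl, mul_one] at hcoeff
  · exact hk₁.2 hcoeff
  · intro k _ hk
    split_ifs
    · rw [MvPolynomial.coeff_C_mul, MvPolynomial.prod_map_X, MvPolynomial.coeff_monomial,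
        if_neg fun h => hk (hw (Multiset.toFinsupp.injective h)), mul_zero]
    · rfl

end Independence

section Valuation
open Polynomial IsDedekindDomain

/-- The point `1` of the affine line. -/
def pointOne : HeightOneSpectrum ℂ[X] where
  asIdeal := Ideal.span {X - C 1}
  isPrime := (Ideal.span_singleton_prime (X_sub_C_ne_zero 1)).mpr (prime_X_sub_C 1)
  ne_bot := by
    rw [Ne, Ideal.span_singleton_eq_bot]
    exact X_sub_C_ne_zero 1

/-- The ring of rational functions that are regular at `1`. -/
def regularAtOne : ValuationSubring (RatFunc ℂ) :=
  (pointOne.valuation (RatFunc ℂ)).valuationSubring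

theorem algebraMap_mem_regularAtOne (p : ℂ[X]) : algebraMap ℂ[X] (RatFunc ℂ) p ∈ regularAtOne :=
  pointOne.valuation_le_one p

/-- The constants inside `regularAtOne`. -/
def constRegularAtOne : ℂ →+* regularAtOne where
  toFun z := ⟨algebraMap ℂ[X] (RatFunc ℂ) (C z), algebraMap_mem_regularAtOne _⟩
  map_one' := Subtype.ext (by simp)
  map_zero' := Subtype.ext (by simp)
  map_add' a b := Subtype.ext (by simp)
  map_mul' a b := Subtype.ext (by simp)

instance : CharZero (IsLocalRing.ResidueField regularAtOne) :=
  charZero_of_injective_ringHom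
    ((IsLocalRing.residue regularAtOne).comp constRegularAtOne).injective

/-- The indeterminate as a function regular at `1`. -/
def varRegularAtOne : regularAtOne :=
  ⟨algebraMap ℂ[X] (RatFunc ℂ) X, algebraMap_mem_regularAtOne X⟩

theorem residue_varRegularAtOne : IsLocalRing.residue regularAtOne varRegularAtOne = 1 := by
  rw [← sub_eq_zero, ← map_one (IsLocalRing.residue regularAtOne), ← map_sub,
    IsLocalRing.residue_eq_zero_iff]
  have h : pointOne.valuation (RatFunc ℂ) (algebraMap ℂ[X] (RatFunc ℂ) (X - C 1)) < 1 :=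
    (pointOne.valuation_lt_one_iff_mem _).mpr (Ideal.mem_span_singleton_self _)
  refine (Valuation.mem_maximalIdeal_iff ..).mpr ?_
  convert h using 2
  simp [varRegularAtOne]

end Valuation

section Presentation

variable {F A : Type} [Field F] {N : ℕ} [Ring A] [Algebra F A] (q : F)

theorem Rc_apply_left (i k x y : Fin N) : Rc F q N (i, k) (x, y)
    = (if i = x then if k = y then if i = k then q else 1 else 0 else 0)
      + (if k = x then if i = y then if i < k then q - q⁻¹ else 0 else 0 else 0) := by
  simp only [Rc, Matrix.of_apply, Prod.mk.injEq, ite_and]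
  congr 1
  split_ifs <;> rfl

theorem Rc_apply_right (j l x y : Fin N) : Rc F q N (x, y) (j, l)
    = (if j = x then if l = y then if l = j then q else 1 else 0 else 0)
      + (if l = x then if j = y then if l < j then q - q⁻¹ else 0 else 0 else 0) := by
  rw [Rc_apply_left]
  congr 1
  · by_cases hx : x = j
    · by_cases hy : y = l
      · simp [hx, hy, eq_comm]
      · simp [hy, Ne.symm hy]
    · simp [hx, Ne.symm hx]
  · by_cases hx : x = l
    · by_cases hy : y = j
      · simp [hx, hy]
      · simp [hy, Ne.symm hy]
    · simp [hx, Ne.symm hx]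

theorem liftF_Rc_mul_apply (X : Matrix (Fin N × Fin N) (Fin N × Fin N) A) (i k : Fin N)
    (r : Fin N × Fin N) :
    (liftF F (Rc F q N) * X : Matrix (Fin N × Fin N) (Fin N × Fin N) A) (i, k) r
      = (if i = k then q else 1) • X (i, k) r + (if i < k then q - q⁻¹ else 0) • X (k, i) r := by
  simp only [Matrix.mul_apply, liftF, Matrix.map_apply, Fintype.sum_prod_type,
    ← Algebra.smul_def, Rc_apply_left, add_smul, Finset.sum_add_distrib]
  simp [ite_smul]

theorem mul_liftF_Rc_apply (X : Matrix (Fin N × Fin N) (Fin N × Fin N) A) (j l : Fin N)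
    (p : Fin N × Fin N) :
    (X * liftF F (Rc F q N) : Matrix (Fin N × Fin N) (Fin N × Fin N) A) p (j, l)
      = (if l = j then q else 1) • X p (j, l) + (if l < j then q - q⁻¹ else 0) • X p (l, j) := by
  simp only [Matrix.mul_apply, liftF, Matrix.map_apply, Fintype.sum_prod_type,
    ← Algebra.commutes, ← Algebra.smul_def, Rc_apply_right, add_smul, Finset.sum_add_distrib]
  simp [ite_smul]

theorem amp1_mul_liftF_Rct_mul_amp2_apply (S : Matrix (Fin N) (Fin N) A) (i j k l : Fin N) :
    (amp1 S * (liftF F (Rct F q N) * amp2 S) : Matrix (Fin N × Fin N) (Fin N × Fin N) A)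
        (i, k) (j, l)
      = (if j = k then q else 1) • (S i j * S k l)
        + (if j < k then q - q⁻¹ else 0) • (S i k * S j l) := by
  have h : ∀ x y : Fin N, S i x * (algebraMap F A (Rct F q N (x, k) (j, y)) * S y l)
      = Rc F q N (j, k) (x, y) • (S i x * S y l) := by
    intro x y
    rw [← Algebra.smul_def, mul_smul_comm]
    rfl
  simp only [Matrix.mul_apply, liftF, Matrix.map_apply, Fintype.sum_prod_type, amp1, amp2,
    Matrix.of_apply, ite_mul, mul_ite, zero_mul, mul_zero, Finset.mul_sum]
  simp [h, Rc_apply_left, add_smul, ite_smul, Finset.sum_add_distrib]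

theorem amp2_mul_liftF_Rct_mul_amp1_apply (S : Matrix (Fin N) (Fin N) A) (i j k l : Fin N) :
    (amp2 S * (liftF F (Rct F q N) * amp1 S) : Matrix (Fin N × Fin N) (Fin N × Fin N) A)
        (i, k) (j, l)
      = (if l = i then q else 1) • (S k l * S i j)
        + (if l < i then q - q⁻¹ else 0) • (S k i * S l j) := by
  have h : ∀ x y : Fin N, S k y * (algebraMap F A (Rct F q N (i, y) (x, l)) * S x j)
      = Rc F q N (x, y) (i, l) • (S k y * S x j) := by
    intro x y
    rw [← Algebra.smul_def, mul_smul_comm]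
    rfl
  simp only [Matrix.mul_apply, liftF, Matrix.map_apply, Fintype.sum_prod_type, amp1, amp2,
    Matrix.of_apply, ite_mul, mul_ite, zero_mul, mul_zero, Finset.sum_ite_eq', Finset.mem_univ,
    if_true, Finset.mul_sum]
  simp [h, Rc_apply_right, add_smul, ite_smul, Finset.sum_add_distrib]

theorem isReflection_iff (S : Matrix (Fin N) (Fin N) A) :
    IsReflection (Fin N) q q⁻¹ S ↔ ∀ p r, reflLHS F q S p r = reflRHS F q S p r := by
  have hL : ∀ i j k l, reflLHS F q S (i, k) (j, l)
      = (if i = k then q else 1) • ((if j = k then q else 1) • (S i j * S k l)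
        + (if j < k then q - q⁻¹ else 0) • (S i k * S j l))
      + (if i < k then q - q⁻¹ else 0) • ((if j = i then q else 1) • (S k j * S i l)
        + (if j < i then q - q⁻¹ else 0) • (S k i * S j l)) := fun i j k l => by
    rw [reflLHS, Matrix.mul_assoc, Matrix.mul_assoc, liftF_Rc_mul_apply,
      amp1_mul_liftF_Rct_mul_amp2_apply, amp1_mul_liftF_Rct_mul_amp2_apply]
  have hR : ∀ i j k l, reflRHS F q S (i, k) (j, l)
      = (if l = j then q else 1) • ((if l = i then q else 1) • (S k l * S i j)
        + (if l < i then q - q⁻¹ else 0) • (S k i * S l j))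
      + (if l < j then q - q⁻¹ else 0) • ((if j = i then q else 1) • (S k j * S i l)
        + (if j < i then q - q⁻¹ else 0) • (S k i * S j l)) := fun i j k l => by
    rw [reflRHS, mul_liftF_Rc_apply, Matrix.mul_assoc,
      amp2_mul_liftF_Rct_mul_amp1_apply, amp2_mul_liftF_Rct_mul_amp1_apply]
  constructor
  · rintro h ⟨i, k⟩ ⟨j, l⟩
    rw [hL, hR]
    exact h i j k l
  · intro h i j k l
    rw [← hL, ← hR]
    exact h (i, k) (j, l)

theorem map_reflLHS {B : Type} [Ring B] [Algebra F B] (f : A →ₐ[F] B)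
    (S : Matrix (Fin N) (Fin N) A) (p r : Fin N × Fin N) :
    f (reflLHS F q S p r) = reflLHS F q (S.map f) p r := by
  simp [reflLHS, Matrix.mul_apply, liftF, amp1, amp2, apply_ite f]

theorem map_reflRHS {B : Type} [Ring B] [Algebra F B] (f : A →ₐ[F] B)
    (S : Matrix (Fin N) (Fin N) A) (p r : Fin N × Fin N) :
    f (reflRHS F q S p r) = reflRHS F q (S.map f) p r := by
  simp [reflRHS, Matrix.mul_apply, liftF, amp1, amp2, apply_ite f]

theorem exists_algHom_AlgOS (S : Fin N → Fin N → A) (hS : IsReflection (Fin N) q q⁻¹ S)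
    (h₀ : ∀ i j, i < j → S i j = 0) (h₁ : ∀ i, S i i = 1) :
    ∃ f : AlgOS F q N →ₐ[F] A, ∀ i j, f (sOS F q N i j) = S i j := by
  let φ : FreeAlgebra F (Fin N × Fin N) →ₐ[F] A := FreeAlgebra.lift F fun p => S p.1 p.2
  have hφ : (Sfree F N).map φ = S := by
    ext i j
    simp [φ, Sfree]
  refine ⟨RingQuot.liftAlgHom F ⟨φ, ?_⟩, fun i j => ?_⟩
  · rintro _ _ (⟨i, j, h⟩ | ⟨i⟩ | ⟨p, r⟩)
    · simp [φ, h₀ i j h]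
    · simp [φ, h₁ i]
    · rw [map_reflLHS, map_reflRHS, hφ, (isReflection_iff q _).mp hS]
  · simp [sOS, φ]

theorem isReflection_sOS : IsReflection (Fin N) q q⁻¹ (sOS F q N) := by
  refine (isReflection_iff q (sOS F q N)).mpr fun p r => ?_
  have h : (Sfree F N).map (RingQuot.mkAlgHom F (OSRel F q N)) = sOS F q N := rfl
  rw [← h, ← map_reflLHS, ← map_reflRHS]
  exact RingQuot.mkAlgHom_rel F (OSRel.refl p r)

theorem sOS_of_lt {i j : Fin N} (h : i < j) : sOS F q N i j = 0 :=
  (RingQuot.mkAlgHom_rel F (OSRel.tri i j h)).trans (map_zero _)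

theorem sOS_self (i : Fin N) : sOS F q N i i = 1 :=
  (RingQuot.mkAlgHom_rel F (OSRel.diag i)).trans (map_one _)

theorem linearIndependent_sOS {κ : Type} (w : κ → List {p : Fin N × Fin N // p.2 < p.1})
    (hw : Function.Injective fun k => (w k : Multiset {p : Fin N × Fin N // p.2 < p.1})) :
    LinearIndependent FF (fun k => ((w k).map fun g => sOS FF qq N g.1.1 g.1.2).prod) := by
  have hu : IsUnit varRegularAtOne := by
    rw [← IsLocalRing.residue_ne_zero_iff_isUnit, residue_varRegularAtOne]
    exact one_ne_zero
  obtain ⟨q', hq⟩ := hu.exists_right_inv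
  have hv : (varRegularAtOne : FF) = qq := by simp [varRegularAtOne, qq]
  have hq' : (q' : FF) = qq⁻¹ := by
    rw [← hv]
    exact eq_inv_of_mul_eq_one_right (congrArg Subtype.val hq)
  refine linearIndependent_lower_monomials regularAtOne hq ?_ residue_varRegularAtOne ?_ w hw
  · intro h
    have hX : (RatFunc.X : RatFunc ℂ) * RatFunc.X = 1 := by
      have := congrArg Subtype.val hq
      rw [← h] at this
      change (varRegularAtOne : FF) * varRegularAtOne = 1 at this
      rwa [hv] at this
    rw [← RatFunc.algebraMap_X, ← map_mul, ← map_one (algebraMap (Polynomial ℂ) (RatFunc ℂ))] at hX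
    simpa using congrArg (Polynomial.eval 0) (RatFunc.algebraMap_injective ℂ hX)
  · intro B _ _ s hs h₀ h₁
    rw [hv, hq'] at hs
    exact exists_algHom_AlgOS qq s hs h₀ h₁

end Presentation

section OrderedWords

variable {N : ℕ}

theorem mem_lexPairs (p : Fin N × Fin N) : p ∈ lexPairs N := by
  simp [lexPairs]

theorem nodup_lexPairs : (lexPairs N).Nodup := by
  have h : lexPairs N = List.finRange N ×ˢ List.finRange N := rfl
  rw [h]
  exact (List.nodup_finRange N).product (List.nodup_finRange N)

/-- The nondecreasing word with prescribed multiplicities. -/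
def orderedWord (k : {p : Fin N × Fin N // p.2 < p.1} → ℕ) :
    List {p : Fin N × Fin N // p.2 < p.1} :=
  (lexPairs N).flatMap fun p => if h : p.2 < p.1 then List.replicate (k ⟨p, h⟩) ⟨p, h⟩ else []

theorem prod_map_orderedWord {A : Type} [Monoid A] (s : Fin N → Fin N → A)
    (k : {p : Fin N × Fin N // p.2 < p.1} → ℕ) :
    ((orderedWord k).map fun g => s g.1.1 g.1.2).prod
      = ((lexPairs N).map fun p =>
          s p.1 p.2 ^ (if h : p.2 < p.1 then k ⟨p, h⟩ else 0)).prod := by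
  unfold orderedWord
  induction lexPairs N with
  | nil => rfl
  | cons p l ih =>
    rw [List.flatMap_cons, List.map_append, List.prod_append, ih, List.map_cons, List.prod_cons]
    split_ifs <;> simp

theorem count_orderedWord (k : {p : Fin N × Fin N // p.2 < p.1} → ℕ)
    (g : {p : Fin N × Fin N // p.2 < p.1}) : (orderedWord k).count g = k g := by
  have h : ∀ p : Fin N × Fin N, (if h : p.2 < p.1 then List.replicate (k ⟨p, h⟩) ⟨p, h⟩ else
      ([] : List {p : Fin N × Fin N // p.2 < p.1})).count g = if g.1 = p then k g else 0 := by
    intro p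
    by_cases hp : g.1 = p
    · subst hp
      simp [g.2]
    · split_ifs with h
      · exact List.count_eq_zero.mpr fun hg =>
          hp (congrArg Subtype.val (List.eq_of_mem_replicate hg))
      · simp
  rw [orderedWord, List.count_flatMap, Function.comp_def]
  simp only [h]
  rw [← List.sum_toFinset _ nodup_lexPairs, Finset.sum_ite_eq]
  simp [mem_lexPairs]

theorem orderedWord_injective :
    Function.Injective fun k : {p : Fin N × Fin N // p.2 < p.1} → ℕ =>
      (orderedWord k : Multiset {p : Fin N × Fin N // p.2 < p.1}) := by
  intro k l h
  funext g
  rw [← count_orderedWord k, ← count_orderedWord l]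
  exact (Multiset.coe_eq_coe.mp h).count_eq g

theorem perm_orderedWord (L : List {p : Fin N × Fin N // p.2 < p.1}) :
    L.Perm (orderedWord fun g => L.count g) :=
  List.perm_iff_count.mpr fun g => (count_orderedWord (fun g => L.count g) g).symm

end OrderedWords

section WordSpan

variable {F A G : Type*} [Field F] [Ring A] [Algebra F A]

/-- The span of the words in `s` of total weight less than `n`. -/
def wordSpan (F : Type*) [Field F] [Algebra F A] (s : G → A) (w : G → ℕ) (n : ℕ) :
    Submodule F A :=
  Submodule.span F {x | ∃ L : List G, (L.map w).sum < n ∧ (L.map s).prod = x}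

variable {s : G → A} {w : G → ℕ}

theorem prod_mem_wordSpan {n : ℕ} (L : List G) (h : (L.map w).sum < n) :
    (L.map s).prod ∈ wordSpan F s w n :=
  Submodule.subset_span ⟨L, h, rfl⟩

theorem mul_prod_mem_wordSpan {n : ℕ} {x : A} (hx : x ∈ wordSpan F s w n) (L : List G) :
    x * (L.map s).prod ∈ wordSpan F s w (n + (L.map w).sum) := by
  have h : wordSpan F s w n ≤ (wordSpan F s w (n + (L.map w).sum)).comap
      (LinearMap.mulRight F (L.map s).prod) := by
    refine Submodule.span_le.mpr ?_
    rintro _ ⟨L', hL', rfl⟩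
    simpa using prod_mem_wordSpan (F := F) (s := s) (w := w) (L' ++ L)
      (n := n + (L.map w).sum) (by simpa using hL')
  exact h hx

theorem mul_mem_wordSpan {n : ℕ} {x : A} (g : G) (hx : x ∈ wordSpan F s w n) :
    s g * x ∈ wordSpan F s w (w g + n) := by
  have h : wordSpan F s w n ≤ (wordSpan F s w (w g + n)).comap (LinearMap.mulLeft F (s g)) := by
    refine Submodule.span_le.mpr ?_
    rintro _ ⟨L, hL, rfl⟩
    simpa using prod_mem_wordSpan (F := F) (s := s) (w := w) (g :: L)
      (n := w g + n) (by simpa using hL)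
  exact h hx

/-- Two elements commute up to a nonzero scalar modulo a subspace. -/
def QuasiCommute (W : Submodule F A) (x y : A) : Prop :=
  ∃ c : F, c ≠ 0 ∧ x * y - c • (y * x) ∈ W

theorem QuasiCommute.symm {W : Submodule F A} {x y : A} (h : QuasiCommute W x y) :
    QuasiCommute W y x := by
  obtain ⟨c, hc, h⟩ := h
  refine ⟨c⁻¹, inv_ne_zero hc, ?_⟩
  have : y * x - c⁻¹ • (x * y) = (-c⁻¹) • (x * y - c • (y * x)) := by
    rw [smul_sub, smul_smul, neg_mul, inv_mul_cancel₀ hc]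
    module
  rw [this]
  exact W.smul_mem _ h

theorem exists_prod_sub_smul_mem_wordSpan
    (hs : ∀ a b, QuasiCommute (wordSpan F s w (w a + w b)) (s a) (s b)) {L L' : List G}
    (h : L.Perm L') : ∃ c : F, (L.map s).prod - c • (L'.map s).prod
      ∈ wordSpan F s w (L.map w).sum := by
  induction h with
  | nil => exact ⟨1, by simp⟩
  | @cons x L₁ L₂ _ ih =>
    obtain ⟨c, hc⟩ := ih
    refine ⟨c, ?_⟩
    simpa [mul_sub] using mul_mem_wordSpan x hc
  | swap x y L =>
    obtain ⟨c, -, hc⟩ := hs y x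
    refine ⟨c, ?_⟩
    simpa [sub_mul, mul_assoc, add_assoc] using mul_prod_mem_wordSpan hc L
  | @trans L₁ L₂ L₃ h₁ _ ih₁ ih₂ =>
    obtain ⟨c, hc⟩ := ih₁
    obtain ⟨d, hd⟩ := ih₂
    refine ⟨c * d, ?_⟩
    rw [← (h₁.map w).sum_eq] at hd
    have := add_mem hc (Submodule.smul_mem _ c hd)
    rwa [smul_sub, smul_smul, sub_add_sub_cancel] at this

theorem prod_mem_span_of_perm
    (hs : ∀ a b, QuasiCommute (wordSpan F s w (w a + w b)) (s a) (s b)) (norm : List G → List G)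
    (hnorm : ∀ L, List.Perm L (norm L)) (L : List G) :
    (L.map s).prod ∈ Submodule.span F (Set.range fun L => ((norm L).map s).prod) := by
  induction hn : (L.map w).sum using Nat.strong_induction_on generalizing L with
  | _ n ih =>
    obtain ⟨c, hc⟩ := exists_prod_sub_smul_mem_wordSpan hs (hnorm L)
    have hle : wordSpan F s w (L.map w).sum
        ≤ Submodule.span F (Set.range fun L => ((norm L).map s).prod) := by
      refine Submodule.span_le.mpr ?_
      rintro _ ⟨L', hL', rfl⟩
      exact ih _ (hn ▸ hL') L' rfl
    rw [← sub_add_cancel (L.map s).prod (c • ((norm L).map s).prod)]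
    exact add_mem (hle hc) (Submodule.smul_mem _ c (Submodule.subset_span ⟨L, rfl⟩))

end WordSpan

section Straightening

variable {F A : Type*} [Field F] [Ring A] [Algebra F A] {N : ℕ} {q : F} {s : Fin N → Fin N → A}

/-- The concave weight `N² + 1 + (i - j)(2N - (i - j))` of the generator `s i j`. -/
def lowerWeight (g : {p : Fin N × Fin N // p.2 < p.1}) : ℕ :=
  (2 * (N : ℤ) ^ 2 + 1 - ((N : ℤ) + (g.1.2 : ℕ) - (g.1.1 : ℕ)) ^ 2).toNat

theorem cast_lowerWeight (g : {p : Fin N × Fin N // p.2 < p.1}) : (lowerWeight g : ℤ)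
    = 2 * (N : ℤ) ^ 2 + 1 - ((N : ℤ) + (g.1.2 : ℕ) - (g.1.1 : ℕ)) ^ 2 := by
  refine Int.toNat_of_nonneg ?_
  have h₁ : ((g.1.2 : ℕ) : ℤ) < (g.1.1 : ℕ) := by exact_mod_cast g.2
  have h₂ : ((g.1.1 : ℕ) : ℤ) < N := by exact_mod_cast g.1.1.2
  have h₃ : (0 : ℤ) ≤ (g.1.2 : ℕ) := by positivity
  nlinarith

theorem lowerWeight_lt_add (a b c : {p : Fin N × Fin N // p.2 < p.1}) :
    lowerWeight c < lowerWeight a + lowerWeight b := by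
  have h (g : {p : Fin N × Fin N // p.2 < p.1}) : N ^ 2 + 1 ≤ lowerWeight g := by
    zify
    rw [cast_lowerWeight]
    have h₁ : ((g.1.2 : ℕ) : ℤ) < (g.1.1 : ℕ) := by exact_mod_cast g.2
    have h₂ : ((g.1.1 : ℕ) : ℤ) < N := by exact_mod_cast g.1.1.2
    have h₃ : (0 : ℤ) ≤ (g.1.2 : ℕ) := by positivity
    nlinarith
  have hc : lowerWeight c ≤ 2 * N ^ 2 + 1 := by
    zify
    rw [cast_lowerWeight]
    nlinarith [sq_nonneg ((N : ℤ) + (c.1.2 : ℕ) - (c.1.1 : ℕ))]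
  have ha := h a
  have hb := h b
  omega

theorem lowerWeight_nested_lt {i j k l : Fin N} (hjl : j < l) (hli : l < i) (hik : i < k) :
    lowerWeight (⟨(k, j), (hjl.trans hli).trans hik⟩ : {p : Fin N × Fin N // p.2 < p.1})
        + lowerWeight ⟨(i, l), hli⟩
      < lowerWeight ⟨(i, j), hjl.trans hli⟩ + lowerWeight ⟨(k, l), hli.trans hik⟩ := by
  zify
  simp only [cast_lowerWeight]
  have h₁ : ((j : ℕ) : ℤ) < (l : ℕ) := by exact_mod_cast hjl
  have h₂ : ((i : ℕ) : ℤ) < (k : ℕ) := by exact_mod_cast hik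
  nlinarith [mul_pos (sub_pos.mpr h₁) (sub_pos.mpr h₂)]

theorem lowerWeight_disjoint_lt {i j k l : Fin N} (hjl : j < l) (hli : l < i) (hik : i < k) :
    lowerWeight (⟨(k, i), hik⟩ : {p : Fin N × Fin N // p.2 < p.1})
        + lowerWeight ⟨(l, j), hjl⟩
      < lowerWeight ⟨(i, j), hjl.trans hli⟩ + lowerWeight ⟨(k, l), hli.trans hik⟩ := by
  zify
  simp only [cast_lowerWeight]
  have h₁ : ((l : ℕ) : ℤ) < (i : ℕ) := by exact_mod_cast hli
  have h₂ : ((k : ℕ) : ℤ) < N := by exact_mod_cast k.2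
  have h₃ : (0 : ℤ) ≤ (j : ℕ) := by positivity
  have h₄ : (0 : ℤ) < 2 * N - ((k : ℕ) - (j : ℕ)) := by linarith
  nlinarith [mul_pos (sub_pos.mpr h₁) h₄]

theorem IsReflection.mul_of_lt_of_gt (hs : IsReflection (Fin N) q q⁻¹ s)
    (h₀ : ∀ i j, i < j → s i j = 0) {i j k l : Fin N} (hik : i < k) (hlj : l < j) (hji : j < i) :
    s i j * s k l = s k l * s i j := by
  have := hs i j k l
  simp [hik, hlj, hji, h₀, hik.ne, hlj.ne, hji.ne, (hlj.trans hji).ne, hlj.trans hji,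
    (hji.trans hik).ne, hji.trans hik] at this
  exact this

theorem IsReflection.mul_of_col_eq (hs : IsReflection (Fin N) q q⁻¹ s)
    (h₀ : ∀ i j, i < j → s i j = 0) (h₁ : ∀ i, s i i = 1) {i j k : Fin N} (hik : i < k)
    (hji : j < i) : s i j * s k j = q⁻¹ • (s k j * s i j + (q - q⁻¹) • s k i) := by
  have := hs i j k j
  simp only [hik, hji, h₀, h₁, hik.ne, hji.ne, (hji.trans hik).ne, hji.trans hik, if_true, if_false,
    lt_irrefl, one_smul, zero_smul, add_zero, smul_zero, mul_one] at this
  rw [← eq_sub_iff_add_eq] at this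
  rw [this]
  module

theorem IsReflection.mul_of_crossing (hs : IsReflection (Fin N) q q⁻¹ s)
    (h₀ : ∀ i j, i < j → s i j = 0) {i j k l : Fin N} (hik : i < k)
    (hjl : j < l) (hli : l < i) :
    s i j * s k l = s k l * s i j
      + ((q - q⁻¹) • (s k i * s l j) - (q - q⁻¹) • (s k j * s i l)) := by
  have := hs i j k l
  have hji := hjl.trans hli
  simp [hik, hji, h₀, hik.ne, hji.ne, (hji.trans hik).ne, hji.trans hik, hjl, hjl.ne', hjl.not_gt,
    hli, hli.ne] at this
  rw [← add_sub_assoc, ← this, add_sub_cancel_right]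

theorem IsReflection.mul_of_chain (hs : IsReflection (Fin N) q q⁻¹ s)
    (h₀ : ∀ i j, i < j → s i j = 0) (h₁ : ∀ i, s i i = 1) {i j k : Fin N} (hik : i < k)
    (hji : j < i) : s i j * s k i = q • (s k i * s i j) - (q - q⁻¹) • s k j := by
  have := hs i j k i
  simp [hik, hji, h₀, h₁, hik.ne, hji.ne, (hji.trans hik).ne, hji.trans hik, hji.ne',
    hji.not_gt] at this
  rw [← this, add_sub_cancel_right]

theorem IsReflection.mul_of_disjoint (hs : IsReflection (Fin N) q q⁻¹ s)
    (h₀ : ∀ i j, i < j → s i j = 0) {i j k l : Fin N} (hji : j < i) (hil : i < l)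
    (hlk : l < k) : s i j * s k l = s k l * s i j := by
  have := hs i j k l
  have hik := hil.trans hlk
  simpa [hik, hji, h₀, hik.ne, hji.ne, (hji.trans hik).ne, hji.trans hik, hil, hil.ne', hil.not_gt,
    hji.trans hil, (hji.trans hil).ne', (hji.trans hil).not_gt] using this

theorem IsReflection.mul_of_row_eq (hs : IsReflection (Fin N) q q⁻¹ s)
    (h₀ : ∀ i j, i < j → s i j = 0) (h₁ : ∀ i, s i i = 1) {i j l : Fin N} (hjl : j < l)
    (hli : l < i) : q • (s i j * s i l) = s i l * s i j + (q - q⁻¹) • s l j := by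
  have := hs i j i l
  have hji := hjl.trans hli
  simpa [hji, h₀, h₁, hji.ne, hjl, hjl.ne', hjl.not_gt, hli, hli.ne] using this

theorem IsReflection.quasiCommute (hq : q ≠ 0) (hs : IsReflection (Fin N) q q⁻¹ s)
    (h₀ : ∀ i j, i < j → s i j = 0) (h₁ : ∀ i, s i i = 1)
    (a b : {p : Fin N × Fin N // p.2 < p.1}) :
    QuasiCommute (wordSpan F (fun g : {p : Fin N × Fin N // p.2 < p.1} => s g.1.1 g.1.2)
      lowerWeight (lowerWeight a + lowerWeight b)) (s a.1.1 a.1.2) (s b.1.1 b.1.2) := by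
  wlog h : a.1.1 < b.1.1 ∨ a.1.1 = b.1.1 ∧ a.1.2 ≤ b.1.2 generalizing a b
  · rw [add_comm]
    exact (this b a (by omega)).symm
  have one (c : {p : Fin N × Fin N // p.2 < p.1}) :=
    prod_mem_wordSpan (F := F) (s := fun g => s g.1.1 g.1.2) [c]
      (by simpa using lowerWeight_lt_add a b c)
  have two (c d : {p : Fin N × Fin N // p.2 < p.1})
      (hcd : lowerWeight c + lowerWeight d < lowerWeight a + lowerWeight b) :=
    prod_mem_wordSpan (F := F) (s := fun g => s g.1.1 g.1.2) [c, d] (by simpa using hcd)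
  simp only [List.map_cons, List.map_nil, List.prod_cons, List.prod_nil, mul_one] at one two
  obtain ⟨⟨i, j⟩, hji : j < i⟩ := a
  obtain ⟨⟨k, l⟩, hlk : l < k⟩ := b
  rcases h with hik | ⟨rfl, hjl⟩
  · change i < k at hik
    rcases lt_trichotomy l j with hlj | rfl | hjl
    · exact ⟨1, one_ne_zero, by simp [hs.mul_of_lt_of_gt h₀ hik hlj hji]⟩
    · refine ⟨q⁻¹, inv_ne_zero hq, ?_⟩
      simp only [hs.mul_of_col_eq h₀ h₁ hik hji, smul_add, add_sub_cancel_left]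
      exact Submodule.smul_mem _ _ (Submodule.smul_mem _ _ (one ⟨(k, i), hik⟩))
    rcases lt_trichotomy l i with hli | rfl | hil
    · refine ⟨1, one_ne_zero, ?_⟩
      simp only [hs.mul_of_crossing h₀ hik hjl hli, one_smul, add_sub_cancel_left]
      exact sub_mem
        (Submodule.smul_mem _ _ (two ⟨(k, i), hik⟩ ⟨(l, j), hjl⟩
          (lowerWeight_disjoint_lt hjl hli hik)))
        (Submodule.smul_mem _ _ (two ⟨(k, j), hji.trans hik⟩ ⟨(i, l), hli⟩
          (lowerWeight_nested_lt hjl hli hik)))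
    · refine ⟨q, hq, ?_⟩
      simp only [hs.mul_of_chain h₀ h₁ hik hji, sub_sub_cancel_left]
      exact neg_mem (Submodule.smul_mem _ _ (one ⟨(k, j), hji.trans hik⟩))
    · exact ⟨1, one_ne_zero, by simp [hs.mul_of_disjoint h₀ hji hil hlk]⟩
  · rcases hjl.eq_or_lt with hjl | hjl
    · obtain rfl : j = l := hjl
      exact ⟨1, one_ne_zero, by simp⟩
    · refine ⟨q⁻¹, inv_ne_zero hq, ?_⟩
      rw [← inv_smul_smul₀ hq (s i j * s i l), hs.mul_of_row_eq h₀ h₁ hjl hlk]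
      simp only [smul_add, add_sub_cancel_left]
      exact Submodule.smul_mem _ _ (Submodule.smul_mem _ _ (one ⟨(l, j), hjl⟩))

end Straightening

section Spanning

variable {F : Type} [Field F] {q : F} {N : ℕ}

theorem span_prod_sOS : Submodule.span F (Set.range
    fun L : List {p : Fin N × Fin N // p.2 < p.1} =>
      (L.map fun g => sOS F q N g.1.1 g.1.2).prod) = ⊤ := by
  have hadj : Algebra.adjoin F
      (Set.range fun g : {p : Fin N × Fin N // p.2 < p.1} => sOS F q N g.1.1 g.1.2) = ⊤ := by
    refine top_unique fun x _ => ?_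
    obtain ⟨y, rfl⟩ := RingQuot.mkAlgHom_surjective F (OSRel F q N) x
    induction y using FreeAlgebra.induction with
    | grade0 r =>
      rw [AlgHom.commutes]
      exact Subalgebra.algebraMap_mem _ r
    | grade1 p =>
      change sOS F q N p.1 p.2 ∈ _
      rcases lt_trichotomy p.1 p.2 with h | h | h
      · rw [sOS_of_lt q h]
        exact zero_mem _
      · rw [h, sOS_self]
        exact one_mem _
      · exact Algebra.subset_adjoin ⟨⟨p, h⟩, rfl⟩
    | mul a b ha hb =>
      rw [map_mul]
      exact mul_mem (ha trivial) (hb trivial)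
    | add a b ha hb =>
      rw [map_add]
      exact add_mem (ha trivial) (hb trivial)
  rw [← Algebra.top_toSubmodule, ← hadj, Algebra.adjoin_eq_span]
  congr 1
  ext x
  rw [SetLike.mem_coe, ← FreeMonoid.mrange_lift, MonoidHom.mem_mrange, Set.mem_range]
  simp only [FreeMonoid.lift_apply]
  exact FreeMonoid.toList.symm.exists_congr_left.trans Iff.rfl

theorem span_orderedWord_sOS (hq : q ≠ 0) : Submodule.span F (Set.range
    fun k : {p : Fin N × Fin N // p.2 < p.1} → ℕ =>
      ((orderedWord k).map fun g => sOS F q N g.1.1 g.1.2).prod) = ⊤ := by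
  rw [← top_le_iff, ← span_prod_sOS, Submodule.span_le]
  rintro _ ⟨L, rfl⟩
  refine Submodule.span_mono ?_ (prod_mem_span_of_perm
    ((isReflection_sOS q).quasiCommute hq (fun i j => sOS_of_lt q) (sOS_self q)) _
    perm_orderedWord L)
  rintro _ ⟨L, rfl⟩
  exact ⟨_, rfl⟩

end Spanning

/-- The ordered monomials `s_21^{k_21} s_31^{k_31} s_32^{k_32} ⋯`
in the generators `s_ij` with `i > j` (in lexicographic order) form a basis of `𝒮`. -/
theorem stmt2 (N : ℕ) :
    LinearIndependent FF (fun k : {p : Fin N × Fin N // p.2 < p.1} → ℕ =>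
      ((lexPairs N).map fun p =>
        sOS FF qq N p.1 p.2 ^ (if h : p.2 < p.1 then k ⟨p, h⟩ else 0)).prod) ∧
    Submodule.span FF (Set.range (fun k : {p : Fin N × Fin N // p.2 < p.1} → ℕ =>
      ((lexPairs N).map fun p =>
        sOS FF qq N p.1 p.2 ^ (if h : p.2 < p.1 then k ⟨p, h⟩ else 0)).prod)) = ⊤ := by
  simp only [← prod_map_orderedWord]
  exact ⟨linearIndependent_sOS orderedWord orderedWord_injective,
    span_orderedWord_sOS RatFunc.X_ne_zero⟩
end
end

section
/- Let s_ij denote the entries of the matrix S = T G T̄ᵗ in U_q(gl_2n). Then for every odd index i = 1, 3, …, 2n−1 the identity s_{i′i′} s_ii − q² s_{i′i} s_{ii′} = q³ holds in U_q(gl_2n). -/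
noncomputable section

open scoped TensorProduct

theorem rttLHS_apply (F : Type) [Field F] (q : F) {N : ℕ} {A : Type} [Ring A] [Algebra F A]
    (X Y : Matrix (Fin N) (Fin N) A) (i j k l : Fin N) :
    rttLHS F q X Y (i, j) (k, l)
      = algebraMap F A (if i = j then q else 1) * (X i k * Y j l)
        + if i < j then algebraMap F A (q - q⁻¹) * (X j k * Y i l) else 0 := by
  have h1 : ∀ c d : Fin N, (liftF F (Rc F q N) * amp1 X : Matrix _ _ A) (i, j) (c, d)
      = (if d = j then algebraMap F A (if i = j then q else 1) * X i c else 0)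
        + if d = i ∧ i < j then algebraMap F A (q - q⁻¹) * X j c else 0 := by
    intro c d
    rw [Matrix.mul_apply, Fintype.sum_prod_type]
    simp only [liftF, amp1, Rc, Matrix.map_apply, Matrix.of_apply, mul_ite, mul_zero,
      Finset.sum_ite_eq', Finset.mem_univ, if_true, map_add, add_mul, Finset.sum_add_distrib,
      apply_ite (algebraMap F A), map_zero, ite_mul, zero_mul, Prod.mk.injEq]
    congr 1
    · rw [Finset.sum_eq_single i (by intro b _ hb; simp [Ne.symm hb]) (by simp)]
      simp [eq_comm]
    · rw [Finset.sum_eq_single j (by intro b _ hb; simp [Ne.symm hb]) (by simp)]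
      simp [eq_comm]
  rw [rttLHS, Matrix.mul_apply, Fintype.sum_prod_type]
  simp only [h1, amp2, Matrix.of_apply, mul_ite, mul_zero, add_mul, ite_mul, zero_mul]
  rw [Finset.sum_eq_single k (by intro b _ hb; simp [hb]) (by simp)]
  simp [Finset.sum_add_distrib, ite_and, mul_assoc]

theorem rttRHS_apply (F : Type) [Field F] (q : F) {N : ℕ} {A : Type} [Ring A] [Algebra F A]
    (X Y : Matrix (Fin N) (Fin N) A) (i j k l : Fin N) :
    rttRHS F q X Y (i, j) (k, l)
      = algebraMap F A (if k = l then q else 1) * (Y j l * X i k)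
        + if l < k then algebraMap F A (q - q⁻¹) * (Y j k * X i l) else 0 := by
  have h1 : ∀ c d : Fin N, (amp2 Y * amp1 X : Matrix _ _ A) (i, j) (c, d) = Y j d * X i c := by
    intro c d
    rw [Matrix.mul_apply, Fintype.sum_prod_type]
    simp [amp1, amp2]
  rw [rttRHS, Matrix.mul_apply, Fintype.sum_prod_type]
  simp only [h1, liftF, Rc, Matrix.map_apply, Matrix.of_apply, map_add, mul_add,
    Finset.sum_add_distrib, apply_ite (algebraMap F A), map_zero, mul_ite, mul_zero,
    Prod.mk.injEq]
  congr 1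
  · rw [Finset.sum_eq_single k (by intro b _ hb; simp [hb]) (by simp)]
    split_ifs with h <;> simp [h, Algebra.commutes]
  · rw [Finset.sum_eq_single l (by intro b _ hb; simp [hb]) (by simp)]
    simp only [ite_and, true_and, if_true, Finset.sum_ite_eq', Finset.mem_univ]
    simp only [← Algebra.commutes]

theorem tE_eq_zero (F : Type) [Field F] (q : F) {N : ℕ} {i j : Fin N} (h : i < j) :
    tE F q N i j = 0 := by
  simpa [tE, Tfree] using RingQuot.mkAlgHom_rel F (GlRel.t_zero (F := F) (q := q) i j h)

theorem tbE_eq_zero (F : Type) [Field F] (q : F) {N : ℕ} {i j : Fin N} (h : j < i) :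
    tbE F q N i j = 0 := by
  simpa [tbE, Tbfree] using RingQuot.mkAlgHom_rel F (GlRel.tb_zero (F := F) (q := q) i j h)

theorem tE_mul_tbE (F : Type) [Field F] (q : F) {N : ℕ} (i : Fin N) :
    tE F q N i i * tbE F q N i i = 1 := by
  simpa [tE, tbE, Tfree, Tbfree] using
    RingQuot.mkAlgHom_rel F (GlRel.t_tb (F := F) (q := q) i)

theorem tbE_mul_tE (F : Type) [Field F] (q : F) {N : ℕ} (i : Fin N) :
    tbE F q N i i * tE F q N i i = 1 := by
  simpa [tE, tbE, Tfree, Tbfree] using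
    RingQuot.mkAlgHom_rel F (GlRel.tb_t (F := F) (q := q) i)

theorem tbE_tE_rel (F : Type) [Field F] (q : F) {N : ℕ} (i j k l : Fin N) :
    algebraMap F _ (if i = j then q else 1) * (tbE F q N i k * tE F q N j l)
        + (if i < j then algebraMap F _ (q - q⁻¹) * (tbE F q N j k * tE F q N i l) else 0)
      = algebraMap F _ (if k = l then q else 1) * (tE F q N j l * tbE F q N i k)
        + if l < k then algebraMap F _ (q - q⁻¹) * (tE F q N j k * tbE F q N i l) else 0 := by
  have h := RingQuot.mkAlgHom_rel F (GlRel.rtbt (F := F) (q := q) (i, j) (k, l))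
  rw [rttLHS_apply, rttRHS_apply] at h
  simpa only [map_add, map_mul, AlgHom.commutes, apply_ite (RingQuot.mkAlgHom F (GlRel F q N)),
    map_zero, Tfree, Tbfree, Matrix.of_apply, tE, tbE] using h

theorem tbE_tbE_rel (F : Type) [Field F] (q : F) {N : ℕ} (i j k l : Fin N) :
    algebraMap F _ (if i = j then q else 1) * (tbE F q N i k * tbE F q N j l)
        + (if i < j then algebraMap F _ (q - q⁻¹) * (tbE F q N j k * tbE F q N i l) else 0)
      = algebraMap F _ (if k = l then q else 1) * (tbE F q N j l * tbE F q N i k)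
        + if l < k then algebraMap F _ (q - q⁻¹) * (tbE F q N j k * tbE F q N i l) else 0 := by
  have h := RingQuot.mkAlgHom_rel F (GlRel.rtbtb (F := F) (q := q) (i, j) (k, l))
  rw [rttLHS_apply, rttRHS_apply] at h
  simpa only [map_add, map_mul, AlgHom.commutes, apply_ite (RingQuot.mkAlgHom F (GlRel F q N)),
    map_zero, Tbfree, Matrix.of_apply, tbE] using h

theorem tbE_tE_diag_comm (F : Type) [Field F] (q : F) {N : ℕ} {a b : Fin N} (h : a < b) :
    tbE F q N b b * tE F q N a a = tE F q N a a * tbE F q N b b := by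
  simpa [h.ne', h.not_gt, h, tE_eq_zero F q h] using tbE_tE_rel F q b a b a

theorem tE_diag_mul_tbE (F : Type) [Field F] (q : F) {N : ℕ} {a b : Fin N} (h : a < b) :
    tE F q N a a * tbE F q N a b = algebraMap F _ q * (tbE F q N a b * tE F q N a a) := by
  simpa [h.ne', h, tE_eq_zero F q h] using (tbE_tE_rel F q a a b a).symm

theorem tbE_diag_mul_tbE (F : Type) [Field F] (q : F) {N : ℕ} {a b : Fin N} (h : a < b) :
    tbE F q N b b * tbE F q N a b = algebraMap F _ q * (tbE F q N a b * tbE F q N b b) := by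
  simpa [h.ne', h.not_gt] using tbE_tbE_rel F q b a b b

theorem fe_lt_fo (n : ℕ) (k : Fin n) : fe n k < fo n k := by
  simp [fe, fo, Fin.lt_def]

theorem sum_tE_fe_mul_tbE_fo (F : Type) [Field F] (q : F) (n : ℕ) (k : Fin n)
    {i j : Fin (2 * n)} (hi : i ≤ fo n k) (hj : fe n k ≤ j) :
    ∑ a : Fin n, tE F q (2 * n) i (fe n a) * tbE F q (2 * n) j (fo n a)
      = tE F q (2 * n) i (fe n k) * tbE F q (2 * n) j (fo n k) := by
  refine Finset.sum_eq_single k (fun m _ hm => ?_) (by simp)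
  rcases lt_or_gt_of_ne hm with h | h
  · rw [tbE_eq_zero, mul_zero]
    simp only [Fin.lt_def, Fin.le_def, fe, fo] at *
    omega
  · rw [tE_eq_zero, zero_mul]
    simp only [Fin.lt_def, Fin.le_def, fe, fo] at *
    omega

theorem sum_tE_fo_mul_tbE_fe (F : Type) [Field F] (q : F) (n : ℕ) (k : Fin n)
    {i j : Fin (2 * n)} (hi : i ≤ fo n k) (hj : fe n k ≤ j) :
    ∑ a : Fin n, tE F q (2 * n) i (fo n a) * tbE F q (2 * n) j (fe n a)
      = tE F q (2 * n) i (fo n k) * tbE F q (2 * n) j (fe n k) := by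
  refine Finset.sum_eq_single k (fun m _ hm => ?_) (by simp)
  rcases lt_or_gt_of_ne hm with h | h
  · rw [tbE_eq_zero, mul_zero]
    simp only [Fin.lt_def, Fin.le_def, fe, fo] at *
    omega
  · rw [tE_eq_zero, zero_mul]
    simp only [Fin.lt_def, Fin.le_def, fe, fo] at *
    omega

/-- On a diagonal `2 × 2` block only the generators indexed by that block contribute. -/
theorem sSp_block (F : Type) [Field F] (q : F) (n : ℕ) (k : Fin n)
    {i j : Fin (2 * n)} (hi : i ≤ fo n k) (hj : fe n k ≤ j) :
    sSp F q n i j = algebraMap F _ q * (tE F q (2 * n) i (fe n k) * tbE F q (2 * n) j (fo n k))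
      - tE F q (2 * n) i (fo n k) * tbE F q (2 * n) j (fe n k) := by
  rw [sSp, sum_tE_fe_mul_tbE_fo F q n k hi hj, sum_tE_fo_mul_tbE_fe F q n k hi hj]

theorem tbE_mul_tE_mul_tbE (F : Type) [Field F] (q : F) {N : ℕ} {a b : Fin N} (h : a < b) :
    tbE F q N b b * (tE F q N a a * tbE F q N a b)
      = (q ^ 2) • (tbE F q N a b * (tE F q N a a * tbE F q N b b)) := by
  rw [tE_diag_mul_tbE F q h, ← Algebra.smul_def, mul_smul_comm, ← mul_assoc,
    tbE_diag_mul_tbE F q h, ← Algebra.smul_def, smul_mul_assoc, smul_smul, mul_assoc,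
    tbE_tE_diag_comm F q h, pow_two]

theorem sSp_quadratic (F : Type) [Field F] (q : F) (n : ℕ) (k : Fin n) :
    sSp F q n (fo n k) (fo n k) * sSp F q n (fe n k) (fe n k)
      - algebraMap F _ (q ^ 2) *
          (sSp F q n (fo n k) (fe n k) * sSp F q n (fe n k) (fo n k))
      = algebraMap F _ (q ^ 3) := by
  have h := fe_lt_fo n k
  have hdiag : tE F q (2 * n) (fo n k) (fo n k) * (tbE F q (2 * n) (fe n k) (fe n k) *
      (tE F q (2 * n) (fe n k) (fe n k) * tbE F q (2 * n) (fo n k) (fo n k))) = 1 := by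
    rw [← mul_assoc (tbE F q (2 * n) (fe n k) (fe n k)), tbE_mul_tE, one_mul, tE_mul_tbE]
  rw [sSp_block F q n k le_rfl h.le, sSp_block F q n k h.le le_rfl,
    sSp_block F q n k le_rfl le_rfl, sSp_block F q n k h.le h.le,
    tE_eq_zero F q h, tbE_eq_zero F q h]
  simp only [← Algebra.smul_def, mul_zero, zero_mul, sub_zero, sub_mul, smul_sub,
    smul_mul_assoc, mul_smul_comm, smul_smul, mul_assoc, tbE_mul_tE_mul_tbE F q h, hdiag]
  rw [Algebra.algebraMap_eq_smul_one]
  module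

/-- For the entries of `S = T G T̄ᵗ` in `U_q(gl_2n)` and every odd index
`i` (0-based: `i = 2k`, `i' = 2k+1`): `s_{i'i'} s_ii − q² s_{i'i} s_{ii'} = q³`. -/
theorem stmt4 (n : ℕ) (k : Fin n) :
    sSp FF qq n (fo n k) (fo n k) * sSp FF qq n (fe n k) (fe n k)
      - algebraMap FF _ (qq ^ 2) *
          (sSp FF qq n (fo n k) (fe n k) * sSp FF qq n (fe n k) (fo n k))
      = algebraMap FF _ (qq ^ 3) :=
  sSp_quadratic FF qq n k
end
end
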